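/- Let φ : ℂⁿ → ℝ be a C² plurisubharmonic function with cω ≤ i∂∂̄φ ≤ Cω for some constants 0 < c ≤ C, let 1 ≤ p ≤ ∞, let W ⊂ ℂⁿ be a uniformly flat smooth closed complex hypersurface, and let Σ ⊂ W be a uniformly separated sequence. If Σ is a sampling sequence for BF^p_φ(ℂⁿ), then W is a sampling hypersurface for BF^p_φ(ℂⁿ). -/

import Mathlib

open MeasureTheory Metric Set
open scoped ENNReal NNReal Topology

noncomputable section

/-- `ℂⁿ` with the Euclidean (Hermitian) norm. -/
abbrev En (n : ℕ) : Type := EuclideanSpace ℂ (Fin n)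

instance (n : ℕ) : MeasurableSpace (En n) := borel _
instance (n : ℕ) : BorelSpace (En n) := ⟨rfl⟩

/-- Lebesgue measure on `ℂⁿ ≅ ℝ^{2n}`, realized as `2n`-dimensional Hausdorff measure. -/
def vol (n : ℕ) : Measure (En n) := μH[(2 * n : ℝ)]

/-- The surface measure `dσ` on a hypersurface `W` induced by `ω^{n-1}`:
a constant multiple of `(2n-2)`-dimensional Hausdorff measure restricted to `W`. -/
def surf (n : ℕ) (W : Set (En n)) : Measure (En n) :=
  ((2 : ℝ≥0∞) ^ (n - 1) * (Nat.factorial (n - 1) : ℝ≥0∞)) •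
    (μH[(2 * n - 2 : ℝ)] : Measure (En n)).restrict W

open Classical in
/-- The weighted `L^p`-"norm" (to the `p`-th power for `p < ∞`) of `F` over the set `S`
with respect to the measure `μ` and the weight `φ`; for `p = ∞` it is the weighted sup. -/
def wNorm {n : ℕ} (p : ℝ≥0∞) (φ : En n → ℝ) (μ : Measure (En n)) (S : Set (En n))
    (F : En n → ℂ) : ℝ≥0∞ :=
  if p = ⊤ then ⨆ z ∈ S, ENNReal.ofReal (‖F z‖ * Real.exp (-φ z))
  else ∫⁻ z in S, ENNReal.ofReal (‖F z‖ ^ p.toReal * Real.exp (-(p.toReal * φ z))) ∂μ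

/-- Real Hessian of `φ` at `z` in the directions `u`, `v`. -/
def hess {n : ℕ} (φ : En n → ℝ) (z u v : En n) : ℝ := fderiv ℝ (fderiv ℝ φ) z u v

/-- The Levi form `i∂∂̄φ(z)(v,v̄) = Σ φ_{j k̄}(z) v_j v̄_k`, expressed through the
real Hessian.  For `φ = ‖z‖²` it equals `‖v‖²`, i.e. `ω = i∂∂̄‖z‖²` corresponds to
`levi = ‖v‖²`. -/
def levi {n : ℕ} (φ : En n → ℝ) (z v : En n) : ℝ :=
  (hess φ z v v + hess φ z (Complex.I • v) (Complex.I • v)) / 4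

/-- `W` is uniformly flat with tubular radius `ε₀`: the neighborhood
`N_{ε₀}(W)` is a tubular neighborhood, i.e. every point of it has a unique nearest
point on `W` and the (smooth) nearest-point projection `pr` is well defined there. -/
def UniformlyFlatWith {n : ℕ} (ε₀ : ℝ) (W : Set (En n)) : Prop :=
  0 < ε₀ ∧ ∃ pr : En n → En n,
    ContDiffOn ℝ (⊤ : ℕ∞) pr {z | Metric.infDist z W < ε₀} ∧
    ∀ z : En n, Metric.infDist z W < ε₀ →
      pr z ∈ W ∧ dist z (pr z) = Metric.infDist z W ∧
        ∀ w ∈ W, dist z w = Metric.infDist z W → w = pr z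

/-- `W` is uniformly flat. -/
def UniformlyFlat {n : ℕ} (W : Set (En n)) : Prop := ∃ ε₀, UniformlyFlatWith ε₀ W

/-- `f` is holomorphic on the complex submanifold `W`: near every point of `W` it is
the restriction of some holomorphic function of the ambient space. -/
def HolOn {n : ℕ} (W : Set (En n)) (f : En n → ℂ) : Prop :=
  ∀ w ∈ W, ∃ U ∈ 𝓝 w, ∃ g : En n → ℂ, DifferentiableOn ℂ g U ∧ Set.EqOn f g (U ∩ W)

/-- The average `φ_r` of `φ` over the ball `B(z,r)`. -/
def avgBall {n : ℕ} (φ : En n → ℝ) (r : ℝ) (z : En n) : ℝ :=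
  ((vol n) (Metric.ball z r)).toReal⁻¹ * ∫ x in Metric.ball z r, φ x ∂(vol n)

/-- The averaged current of integration `Υ_W(z,r)(v,v̄)`: by Lelong–Poincaré,
`Υ_W(z,r)(v,v) = (π / vol B(z,r)) ∫_{W ∩ B(z,r)} |⟨v, n_w⟩|² dσ(w)`, where the unit
normal pairing is `|⟨v, n_w⟩| = ‖dT_w(v)‖ / ‖dT_w‖` for a defining function `T` of `W`. -/
def Upsilon {n : ℕ} (T : En n → ℂ) (W : Set (En n)) (r : ℝ) (z v : En n) : ℝ :=
  (Real.pi / ((vol n) (Metric.ball z r)).toReal) *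
    ∫ w in Metric.ball z r, (‖fderiv ℂ T w v‖ / ‖fderiv ℂ T w‖) ^ 2 ∂(surf n W)

/-- A set of points of `ℂⁿ` is uniformly separated if distinct points are at least a
fixed positive distance apart. -/
def UnifSep {n : ℕ} (S : Set (En n)) : Prop :=
  ∃ δ > (0 : ℝ), ∀ x ∈ S, ∀ y ∈ S, x ≠ y → δ ≤ dist x y

open Classical in
/-- The weighted `ℓ^p`-"norm" (to the `p`-th power for `p < ∞`) of the restriction of
`F` to the points of `S`; for `p = ∞` the weighted sup over `S`. -/
def seqNorm {n : ℕ} (p : ℝ≥0∞) (ψ : En n → ℝ) (S : Set (En n)) (F : En n → ℂ) : ℝ≥0∞ :=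
  if p = ⊤ then ⨆ σ ∈ S, ENNReal.ofReal (‖F σ‖ * Real.exp (-ψ σ))
  else ∑' σ : S, ENNReal.ofReal (‖F (σ : En n)‖ ^ p.toReal *
    Real.exp (-(p.toReal * ψ (σ : En n))))

/-- `S` is a sampling sequence for `BF^p_φ(ℂⁿ)` (two-sided comparison; weighted suprema
when `p = ∞`). -/
def IsSamplingSeq {n : ℕ} (p : ℝ≥0∞) (φ : En n → ℝ) (S : Set (En n)) : Prop :=
  ∃ M > (0 : ℝ), ∀ F : En n → ℂ, Differentiable ℂ F →
    wNorm p φ (vol n) Set.univ F < ⊤ →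
    wNorm p φ (vol n) Set.univ F ≤ ENNReal.ofReal M * seqNorm p φ S F ∧
    seqNorm p φ S F ≤ ENNReal.ofReal M * wNorm p φ (vol n) Set.univ F

/-- `W` is a sampling hypersurface for `BF^p_φ(ℂⁿ)` (two-sided comparison; weighted
suprema when `p = ∞`). -/
def IsSamplingHyp {n : ℕ} (p : ℝ≥0∞) (φ : En n → ℝ) (W : Set (En n)) : Prop :=
  ∃ M > (0 : ℝ), ∀ F : En n → ℂ, Differentiable ℂ F →
    wNorm p φ (vol n) Set.univ F < ⊤ →
    wNorm p φ (vol n) Set.univ F ≤ ENNReal.ofReal M * wNorm p φ (surf n W) W F ∧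
    wNorm p φ (surf n W) W F ≤ ENNReal.ofReal M * wNorm p φ (vol n) Set.univ F

theorem hasDerivAt_intervalIntegral_of_continuousOn {f f' : ℝ → ℝ → ℝ} {s : Set ℝ}
    (hs : IsOpen s) {a b t₀ : ℝ} (ht₀ : t₀ ∈ s)
    (hf : ∀ t ∈ s, Continuous (f t))
    (hf' : ContinuousOn (Function.uncurry f') (s ×ˢ univ))
    (hd : ∀ t ∈ s, ∀ θ, HasDerivAt (fun t ↦ f t θ) (f' t θ) t) :
    HasDerivAt (fun t ↦ ∫ θ in a..b, f t θ) (∫ θ in a..b, f' t₀ θ) t₀ := by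
  obtain ⟨ε, hε, hεs⟩ := Metric.nhds_basis_closedBall.mem_iff.1 (hs.mem_nhds ht₀)
  have hK : IsCompact (closedBall t₀ ε ×ˢ uIcc a b) :=
    (isCompact_closedBall _ _).prod isCompact_uIcc
  obtain ⟨B, hB⟩ := hK.exists_bound_of_continuousOn
    (hf'.mono (prod_mono hεs (subset_univ _)))
  have hc : Continuous (f' t₀) := by
    rw [← continuousOn_univ]
    exact hf'.comp (f := fun θ ↦ (t₀, θ)) (by fun_prop) (fun θ _ ↦ ⟨ht₀, mem_univ _⟩)
  refine (intervalIntegral.hasDerivAt_integral_of_dominated_loc_of_deriv_le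
    (s := closedBall t₀ ε) (bound := fun _ ↦ B) (closedBall_mem_nhds _ hε) ?_
    ((hf t₀ ht₀).intervalIntegrable _ _) hc.aestronglyMeasurable ?_
    intervalIntegrable_const ?_).2
  · filter_upwards [hs.mem_nhds ht₀] with t ht using (hf t ht).aestronglyMeasurable
  · exact .of_forall fun θ hθ t ht ↦ hB (t, θ) ⟨ht, uIoc_subset_uIcc hθ⟩
  · exact .of_forall fun θ _ t ht ↦ hd t (hεs ht) θ

/-- A `C²` function whose Levi form is at most `C` satisfies a mean value inequality, with error
`C * L ^ 2`, along analytic discs of speed at most `L`. -/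
theorem circleAverage_comp_le_add {E : Type*} [NormedAddCommGroup E] [NormedSpace ℂ E]
    [CompleteSpace E]
    [NormedSpace ℝ E] [IsScalarTower ℝ ℂ E] {φ : E → ℝ} (hφ : ContDiff ℝ 2 φ) {C L R : ℝ}
    (hu : ∀ z v : E, fderiv ℝ (fderiv ℝ φ) z v v +
      fderiv ℝ (fderiv ℝ φ) z (Complex.I • v) (Complex.I • v) ≤ 4 * C * ‖v‖ ^ 2)
    (hC : 0 ≤ C) {η : ℂ → E} (hR : 1 < R) (hη : DifferentiableOn ℂ η (ball 0 R))
    (hL : ∀ z ∈ ball (0 : ℂ) R, ‖deriv η z‖ ≤ L) :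
    Real.circleAverage (φ ∘ η) 0 1 ≤ φ (η 0) + C * L ^ 2 := by
  have hη1 : DifferentiableOn ℂ (deriv η) (ball 0 R) := hη.deriv isOpen_ball
  have hη2 : DifferentiableOn ℂ (deriv (deriv η)) (ball 0 R) := hη1.deriv isOpen_ball
  have hd0 : ∀ z ∈ ball (0 : ℂ) R, HasDerivAt η (deriv η z) z := fun z hz ↦
    (hη.differentiableAt (isOpen_ball.mem_nhds hz)).hasDerivAt
  have hd1 : ∀ z ∈ ball (0 : ℂ) R, HasDerivAt (deriv η) (deriv (deriv η) z) z := fun z hz ↦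
    (hη1.differentiableAt (isOpen_ball.mem_nhds hz)).hasDerivAt
  set D := fderiv ℝ φ with hD
  set D2 := fderiv ℝ D with hD2
  have hφ1 : ∀ z, HasFDerivAt φ (D z) z := fun z ↦
    (hφ.differentiable (by norm_num) z).hasFDerivAt
  have hDc : ContDiff ℝ 1 D := hφ.fderiv_right (by norm_num)
  have hφ2 : ∀ z, HasFDerivAt D (D2 z) z := fun z ↦
    (hDc.differentiable (by norm_num) z).hasFDerivAt
  have hD2c : Continuous D2 := hDc.continuous_fderiv (by norm_num)
  have hDcont : Continuous D := hDc.continuous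
  let e : ℝ → ℂ := fun θ ↦ Complex.exp (θ * Complex.I)
  have hec : Continuous e := by fun_prop
  have hen : ∀ θ, ‖e θ‖ = 1 := fun θ ↦ Complex.norm_exp_ofReal_mul_I θ
  have hed : ∀ θ, HasDerivAt e (Complex.I * e θ) θ := fun θ ↦ by
    have : HasDerivAt (fun θ : ℝ ↦ (θ : ℂ) * Complex.I) (1 * Complex.I) θ :=
      (Complex.ofRealCLM.hasDerivAt (x := θ)).mul_const _
    simpa [e, mul_comm] using this.cexp
  set s : Set ℝ := Ioo (-R) R with hs
  have hmem : ∀ t ∈ s, ∀ θ, (t : ℂ) * e θ ∈ ball (0 : ℂ) R := fun t ht θ ↦ by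
    simpa [hen, abs_lt, hs] using ht
  have hpc : ContinuousOn (fun q : ℝ × ℝ ↦ (q.1 : ℂ) * e q.2) (s ×ˢ univ) := by
    fun_prop
  have hpm : MapsTo (fun q : ℝ × ℝ ↦ (q.1 : ℂ) * e q.2) (s ×ˢ univ) (ball 0 R) :=
    fun q hq ↦ hmem q.1 hq.1 q.2
  have c0 := hη.continuousOn.comp hpc hpm
  have c1 := hη1.continuousOn.comp hpc hpm
  have c2 := hη2.continuousOn.comp hpc hpm
  let f : ℝ → ℝ → ℝ := fun t θ ↦ φ (η (t * e θ))
  let a : ℝ → ℝ → ℝ := fun t θ ↦ D (η (t * e θ)) (e θ • deriv η (t * e θ))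
  let a' : ℝ → ℝ → ℝ := fun t θ ↦
    D2 (η (t * e θ)) (e θ • deriv η (t * e θ)) (e θ • deriv η (t * e θ)) +
      D (η (t * e θ)) (e θ • e θ • deriv (deriv η) (t * e θ))
  let b : ℝ → ℝ → ℝ := fun t θ ↦ D (η (t * e θ)) ((Complex.I * e θ) • deriv η (t * e θ))
  let b' : ℝ → ℝ → ℝ := fun t θ ↦
    D2 (η (t * e θ)) ((t * (Complex.I * e θ)) • deriv η (t * e θ))
      ((Complex.I * e θ) • deriv η (t * e θ)) +
      D (η (t * e θ)) ((Complex.I * e θ) • (t * (Complex.I * e θ)) • deriv (deriv η) (t * e θ) +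
        (Complex.I * (Complex.I * e θ)) • deriv η (t * e θ))
  have hp1 : ∀ t θ, HasDerivAt (fun t : ℝ ↦ (t : ℂ) * e θ) (e θ) t := fun t θ ↦ by
    simpa using (Complex.ofRealCLM.hasDerivAt (x := t)).mul_const (e θ)
  have hp2 : ∀ t θ : ℝ, HasDerivAt (fun θ : ℝ ↦ (t : ℂ) * e θ) (t * (Complex.I * e θ)) θ :=
    fun t θ ↦ (hed θ).const_mul _
  have hfa : ∀ t ∈ s, ∀ θ, HasDerivAt (fun t ↦ f t θ) (a t θ) t := fun t ht θ ↦
    (hφ1 _).comp_hasDerivAt t ((hd0 _ (hmem t ht θ)).scomp t (hp1 t θ))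
  have haa : ∀ t ∈ s, ∀ θ, HasDerivAt (fun t ↦ a t θ) (a' t θ) t := fun t ht θ ↦
    ((hφ2 _).comp_hasDerivAt t ((hd0 _ (hmem t ht θ)).scomp t (hp1 t θ))).clm_apply
      (((hd1 _ (hmem t ht θ)).scomp t (hp1 t θ)).const_smul (e θ))
  have hsc : ∀ t ∈ s, ∀ θ, HasDerivAt (fun θ : ℝ ↦ deriv η (t * e θ))
      ((t * (Complex.I * e θ)) • deriv (deriv η) (t * e θ)) θ := fun t ht θ ↦
    HasDerivAt.scomp (h := fun θ : ℝ ↦ (t : ℂ) * e θ) θ (hd1 _ (hmem t ht θ)) (hp2 t θ)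
  have hbb : ∀ t ∈ s, ∀ θ, HasDerivAt (fun θ ↦ b t θ) (b' t θ) θ := fun t ht θ ↦
    ((hφ2 _).comp_hasDerivAt θ ((hd0 _ (hmem t ht θ)).scomp θ (hp2 t θ))).clm_apply
      (((hed θ).const_mul Complex.I).smul (hsc t ht θ))
  have hce : ContinuousOn (fun q : ℝ × ℝ ↦ e q.2) (s ×ˢ univ) := by fun_prop
  have hca : ContinuousOn (Function.uncurry a) (s ×ˢ univ) :=
    (hDcont.comp_continuousOn c0).clm_apply (hce.smul c1)
  have hca' : ContinuousOn (Function.uncurry a') (s ×ˢ univ) :=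
    (((hD2c.comp_continuousOn c0).clm_apply (hce.smul c1)).clm_apply (hce.smul c1)).add
      ((hDcont.comp_continuousOn c0).clm_apply (hce.smul (hce.smul c2)))
  have hcf : ContinuousOn (Function.uncurry f) (s ×ˢ univ) :=
    hφ.continuous.comp_continuousOn c0
  have slice : ∀ g : ℝ → ℝ → ℝ, ContinuousOn (Function.uncurry g) (s ×ˢ univ) → ∀ t ∈ s,
      Continuous (g t) := fun g hg t ht ↦ by
    rw [← continuousOn_univ]
    exact hg.comp (f := fun θ ↦ (t, θ)) (by fun_prop) (fun θ _ ↦ ⟨ht, mem_univ _⟩)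
  have hcb' : ContinuousOn (Function.uncurry b') (s ×ˢ univ) := by
    have hct : ContinuousOn (fun q : ℝ × ℝ ↦ (q.1 : ℂ) * (Complex.I * e q.2)) (s ×ˢ univ) := by
      fun_prop
    have hcI : ContinuousOn (fun q : ℝ × ℝ ↦ Complex.I * e q.2) (s ×ˢ univ) := by fun_prop
    have hcII : ContinuousOn (fun q : ℝ × ℝ ↦ Complex.I * (Complex.I * e q.2)) (s ×ˢ univ) := by
      fun_prop
    exact (((hD2c.comp_continuousOn c0).clm_apply (hct.smul c1)).clm_apply (hcI.smul c1)).add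
      ((hDcont.comp_continuousOn c0).clm_apply ((hcI.smul (hct.smul c2)).add (hcII.smul c1)))
  have hso : IsOpen s := isOpen_Ioo
  have hm : ∀ t ∈ s, HasDerivAt (fun t ↦ ∫ θ in (0)..2 * Real.pi, f t θ)
      (∫ θ in (0)..2 * Real.pi, a t θ) t := fun t ht ↦
    hasDerivAt_intervalIntegral_of_continuousOn hso ht (slice f hcf) hca hfa
  have hA : ∀ t ∈ s, HasDerivAt (fun t ↦ ∫ θ in (0)..2 * Real.pi, a t θ)
      (∫ θ in (0)..2 * Real.pi, a' t θ) t := fun t ht ↦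
    hasDerivAt_intervalIntegral_of_continuousOn hso ht (slice a hca) hca' haa
  set A : ℝ → ℝ := fun t ↦ ∫ θ in (0)..2 * Real.pi, a t θ with hAdef
  have hIcc : Icc (0 : ℝ) 1 ⊆ s := fun t ht ↦ ⟨by linarith [ht.1], by linarith [ht.2]⟩
  have hkey : ∀ t ∈ s, 0 ≤ t →
      A t + t * ∫ θ in (0)..2 * Real.pi, a' t θ ≤ 2 * Real.pi * (4 * C * L ^ 2 * t) := by
    intro t ht h0
    have hb0 : ∫ θ in (0)..2 * Real.pi, b' t θ = 0 := by
      rw [intervalIntegral.integral_eq_sub_of_hasDerivAt (fun θ _ ↦ hbb t ht θ)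
        ((slice b' hcb' t ht).intervalIntegrable _ _)]
      simp [b, e]
    have ia := (slice a hca t ht).intervalIntegrable (μ := volume) 0 (2 * Real.pi)
    have ia' := ((slice a' hca' t ht).intervalIntegrable (μ := volume) 0 (2 * Real.pi)).const_mul t
    have ib := (slice b' hcb' t ht).intervalIntegrable (μ := volume) 0 (2 * Real.pi)
    have : A t + t * ∫ θ in (0)..2 * Real.pi, a' t θ =
        ∫ θ in (0)..2 * Real.pi, (a t θ + t * a' t θ + b' t θ) := by
      rw [intervalIntegral.integral_add (ia.add ia') ib, intervalIntegral.integral_add ia ia', hb0,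
        add_zero, intervalIntegral.integral_const_mul]
    rw [this]
    have hmono := intervalIntegral.integral_mono_on (f := fun θ ↦ a t θ + t * a' t θ + b' t θ)
      (g := fun _ ↦ 4 * C * L ^ 2 * t) (μ := volume) Real.two_pi_pos.le
      ((ia.add ia').add ib) intervalIntegrable_const ?_
    · simp at hmono
      linarith
    intro θ _
    have hcs : ∀ x : E, (t : ℂ) • x = t • x := fun x ↦ algebraMap_smul ℂ t x
    have hI : Complex.I * (Complex.I * e θ) = - e θ := by
      rw [← mul_assoc, Complex.I_mul_I]; ring
    have hs2 : (Complex.I * e θ) • ((t : ℂ) * (Complex.I * e θ)) • deriv (deriv η) (t * e θ) =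
        -(t • e θ • e θ • deriv (deriv η) (t * e θ)) := by
      rw [← hcs]
      simp only [smul_smul, ← neg_smul]
      congr 1
      linear_combination (t : ℂ) * e θ * e θ * Complex.I_mul_I
    have hs1 : ((t : ℂ) * (Complex.I * e θ)) • deriv η (t * e θ) =
        t • Complex.I • e θ • deriv η (t * e θ) := by
      rw [← hcs]; simp only [smul_smul]
    have := hu (η (t * e θ)) (e θ • deriv η (t * e θ))
    have hn : ‖e θ • deriv η (t * e θ)‖ ^ 2 ≤ L ^ 2 := by
      rw [norm_smul, hen, one_mul]
      exact pow_le_pow_left₀ (norm_nonneg _) (hL _ (hmem t ht θ)) 2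
    have h4 : 4 * C * ‖e θ • deriv η (t * e θ)‖ ^ 2 ≤ 4 * C * L ^ 2 := by gcongr
    have h5 := mul_le_mul_of_nonneg_left (this.trans h4) h0
    simp only [a, a', b']
    rw [hs2, hs1, hI, mul_smul Complex.I (e θ)]
    simp only [neg_smul, map_add, map_neg, map_smul, smul_eq_mul, smul_apply]
    linarith
  have hmonoA : MonotoneOn (fun t ↦ 4 * Real.pi * C * L ^ 2 * t ^ 2 - t * A t) (Icc 0 1) := by
    have hd : ∀ t ∈ s, HasDerivAt (fun t ↦ 4 * Real.pi * C * L ^ 2 * t ^ 2 - t * A t)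
        (4 * Real.pi * C * L ^ 2 * (2 * t) -
          (1 * A t + t * ∫ θ in (0)..2 * Real.pi, a' t θ)) t := fun t ht ↦ by
      simpa using! ((hasDerivAt_pow 2 t).const_mul (4 * Real.pi * C * L ^ 2)).sub
        ((hasDerivAt_id t).mul (hA t ht))
    refine monotoneOn_of_deriv_nonneg (convex_Icc _ _)
      (fun t ht ↦ (hd t (hIcc ht)).continuousAt.continuousWithinAt)
      (fun t ht ↦ (hd t (hIcc (interior_subset ht))).differentiableAt.differentiableWithinAt) ?_
    intro t ht
    have ht' := interior_subset ht
    rw [(hd t (hIcc ht')).deriv]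
    linarith [hkey t (hIcc ht') ht'.1]
  have hAle : ∀ t ∈ Ioo (0 : ℝ) 1, A t ≤ 4 * Real.pi * C * L ^ 2 * t := fun t ht ↦ by
    have := hmonoA (left_mem_Icc.2 zero_le_one) (Ioo_subset_Icc_self ht) ht.1.le
    simp only [zero_mul, ne_eq, OfNat.ofNat_ne_zero, not_false_eq_true, zero_pow, mul_zero,
      sub_zero] at this
    have h2 : t * A t ≤ t * (4 * Real.pi * C * L ^ 2 * t) := by linarith
    exact le_of_mul_le_mul_left h2 ht.1
  have hmonoM : MonotoneOn (fun t ↦ 2 * Real.pi * C * L ^ 2 * t ^ 2 -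
      ∫ θ in (0)..2 * Real.pi, f t θ) (Icc 0 1) := by
    have hd : ∀ t ∈ s, HasDerivAt (fun t ↦ 2 * Real.pi * C * L ^ 2 * t ^ 2 -
        ∫ θ in (0)..2 * Real.pi, f t θ) (2 * Real.pi * C * L ^ 2 * (2 * t) - A t) t :=
      fun t ht ↦ by
        simpa using! ((hasDerivAt_pow 2 t).const_mul (2 * Real.pi * C * L ^ 2)).sub (hm t ht)
    refine monotoneOn_of_deriv_nonneg (convex_Icc _ _)
      (fun t ht ↦ (hd t (hIcc ht)).continuousAt.continuousWithinAt)
      (fun t ht ↦ (hd t (hIcc (interior_subset ht))).differentiableAt.differentiableWithinAt) ?_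
    intro t ht
    rw [(hd t (hIcc (interior_subset ht))).deriv]
    rw [interior_Icc] at ht
    linarith [hAle t ht]
  have hfin := hmonoM (left_mem_Icc.2 zero_le_one) (right_mem_Icc.2 zero_le_one) zero_le_one
  have hf0 : ∫ θ in (0)..2 * Real.pi, f 0 θ = 2 * Real.pi * φ (η 0) := by simp [f]
  have hf1 : Real.circleAverage (φ ∘ η) 0 1 = (2 * Real.pi)⁻¹ * ∫ θ in (0)..2 * Real.pi, f 1 θ := by
    simp [Real.circleAverage, f, circleMap, e]
  simp only [hf0] at hfin
  rw [hf1, inv_mul_le_iff₀ Real.two_pi_pos]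
  linarith

theorem log_norm_le_circleAverage {g : ℂ → ℂ} {c : ℂ} {R : ℝ} (hR : 0 < R)
    (hg : AnalyticOnNhd ℂ g (closedBall c R)) (h0 : g c ≠ 0) :
    Real.log ‖g c‖ ≤ Real.circleAverage (fun z ↦ Real.log ‖g z‖) c R := by
  have hR' : |R| = R := abs_of_pos hR
  rw [AnalyticOnNhd.circleAverage_log_norm hR.ne' (by rwa [hR']) h0, hR']
  refine le_add_of_nonneg_left (finsum_nonneg fun u ↦ ?_)
  by_cases hu : u ∈ closedBall c R
  · refine mul_nonneg (by exact_mod_cast (MeromorphicOn.AnalyticOnNhd.divisor_nonneg hg) u) ?_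
    by_cases hcu : c = u
    · simp [hcu]
    refine Real.log_nonneg ?_
    have hpos : 0 < ‖c - u‖ := norm_pos_iff.2 (sub_ne_zero.2 hcu)
    rw [← div_eq_mul_inv, one_le_div hpos]
    rwa [mem_closedBall, dist_comm, dist_eq_norm] at hu
  · simp [hu]

/-- Sub-mean value inequality for `‖g‖ ^ P * exp (-P ψ)`, with `g` analytic and `ψ` satisfying an
approximate mean value inequality. -/
theorem norm_rpow_mul_exp_le_circleAverage {g : ℂ → ℂ} {ψ : ℂ → ℝ} {c : ℂ} {R P K : ℝ}
    (hR : 0 < R) (hP : 0 < P) (hg : AnalyticOnNhd ℂ g (closedBall c R))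
    (hψ : ContinuousOn ψ (sphere c R)) (hK : Real.circleAverage ψ c R ≤ ψ c + K) :
    ‖g c‖ ^ P * Real.exp (-(P * ψ c)) ≤
      Real.exp (P * K) *
        Real.circleAverage (fun z ↦ ‖g z‖ ^ P * Real.exp (-(P * ψ z))) c R := by
  classical
  have hR' : |R| = R := abs_of_pos hR
  set v : ℂ → ℝ := fun z ↦ ‖g z‖ ^ P * Real.exp (-(P * ψ z)) with hv
  have hv0 : ∀ z, 0 ≤ v z := fun z ↦ by positivity
  by_cases h0 : g c = 0
  · rw [h0, norm_zero, Real.zero_rpow hP.ne', zero_mul]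
    exact mul_nonneg (Real.exp_pos _).le
      (Real.circleAverage_nonneg_of_nonneg fun z _ ↦ hv0 z)
  have hgs : AnalyticOnNhd ℂ g (sphere c |R|) := by
    rw [hR']; exact hg.mono sphere_subset_closedBall
  set a : ℂ → ℝ := fun z ↦ P * Real.log ‖g z‖ - P * ψ z with ha
  have hexp : ∀ z, g z ≠ 0 → Real.exp (a z) = v z := fun z hz ↦ by
    rw [ha, hv]; simp only
    rw [Real.rpow_def_of_pos (norm_pos_iff.2 hz), sub_eq_add_neg, Real.exp_add, mul_comm P]
  set b : ℝ := a c - P * K with hb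
  let m : ℂ → ℝ := fun z ↦ Real.exp b * (1 - b + a z)
  have hle : ∀ z, m z ≤ Real.exp (a z) := fun z ↦ by
    have := Real.add_one_le_exp (a z - b)
    rw [Real.exp_sub, le_div_iff₀ (Real.exp_pos b)] at this
    simp only [m]; linarith
  have hvc : ContinuousOn v (sphere c |R|) := by
    refine ((hgs.continuousOn.norm).rpow_const fun _ _ ↦ .inr hP.le).mul ?_
    rw [hR']
    exact (continuousOn_const.mul hψ).neg.rexp
  have hvi : CircleIntegrable v c R := hvc.circleIntegrable'
  have hli : CircleIntegrable (fun z ↦ Real.log ‖g z‖) c R :=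
    hgs.meromorphicOn.circleIntegrable_log_norm
  have hψi : CircleIntegrable ψ c R := ContinuousOn.circleIntegrable' (by rwa [hR'])
  have hai : CircleIntegrable a c R := (hli.const_fun_smul (a := P)).sub (hψi.const_fun_smul (a := P))
  have hmi : CircleIntegrable m c R :=
    ((circleIntegrable_const (1 - b) c R).add hai).const_fun_smul (a := Real.exp b)
  have hcod : {z | g z ≠ 0} ∈ Filter.codiscreteWithin (sphere c |R|) := by
    refine Filter.codiscreteWithin_mono (by rw [hR']; exact sphere_subset_closedBall)
      (hg.preimage_zero_mem_codiscreteWithin h0 (mem_closedBall_self hR.le)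
        ⟨⟨c, mem_closedBall_self hR.le⟩, (convex_closedBall c R).isPreconnected⟩)
  have hww : v =ᶠ[Filter.codiscreteWithin (sphere c |R|)] fun z ↦ max (v z) (m z) := by
    filter_upwards [hcod] with z hz
    rw [max_eq_left]
    exact (hle z).trans (hexp z hz).le
  have h1 : Real.circleAverage m c R ≤ Real.circleAverage v c R := by
    rw [Real.circleAverage_congr_codiscreteWithin hww hR.ne']
    exact Real.circleAverage_mono hmi (hvi.congr_codiscreteWithin hww) fun z _ ↦ le_max_right _ _
  have h2 : Real.circleAverage m c R = Real.exp b * (1 - b + Real.circleAverage a c R) := by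
    have e1 := Real.circleAverage_fun_smul (a := Real.exp b) (f := fun z ↦ 1 - b + a z) (c := c)
      (R := R)
    have e2 := Real.circleAverage_fun_add (circleIntegrable_const (1 - b) c R) hai
    rw [Real.circleAverage_const] at e2
    simp only [smul_eq_mul] at e1
    rw [e1, e2]
  have h3 : Real.circleAverage a c R =
      P * Real.circleAverage (fun z ↦ Real.log ‖g z‖) c R - P * Real.circleAverage ψ c R := by
    have e1 := Real.circleAverage_fun_smul (a := P) (f := fun z ↦ Real.log ‖g z‖) (c := c)
      (R := R)
    have e2 := Real.circleAverage_fun_smul (a := P) (f := ψ) (c := c) (R := R)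
    have e3 := Real.circleAverage_fun_sub (hli.const_fun_smul (a := P))
      (hψi.const_fun_smul (a := P))
    simp only [smul_eq_mul] at e1 e2 e3
    rw [← e1, ← e2, ← e3]
  have h4 : b ≤ Real.circleAverage a c R := by
    rw [h3, hb]
    have := mul_le_mul_of_nonneg_left (log_norm_le_circleAverage hR hg h0) hP.le
    have := mul_le_mul_of_nonneg_left hK hP.le
    simp only [ha]; linarith
  have h5 : Real.exp b ≤ Real.circleAverage v c R := by
    refine le_trans ?_ h1
    rw [h2]
    nlinarith [Real.exp_pos b]
  calc v c = Real.exp (P * K) * Real.exp b := by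
        rw [← hexp c h0, ← Real.exp_add, hb]; congr 1; ring
    _ ≤ _ := by gcongr

/-- The density `|F| ^ P * exp (-P φ)` of the weighted norms. -/
def density {E : Type*} (P : ℝ) (φ : E → ℝ) (F : E → ℂ) (z : E) : ℝ≥0∞ :=
  ENNReal.ofReal (‖F z‖ ^ P * Real.exp (-(P * φ z)))

theorem continuous_density {E : Type*} [TopologicalSpace E] {P : ℝ} (hP : 0 ≤ P) {φ : E → ℝ}
    (hφ : Continuous φ) {F : E → ℂ} (hF : Continuous F) : Continuous (density P φ F) :=
  ENNReal.continuous_ofReal.comp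
    ((hF.norm.rpow_const fun _ ↦ .inr hP).mul (continuous_const.mul hφ).neg.rexp)

theorem density_le_lintegral_circle {E : Type*} [NormedAddCommGroup E] [NormedSpace ℂ E]
    [CompleteSpace E] [NormedSpace ℝ E] [IsScalarTower ℝ ℂ E] {φ : E → ℝ}
    (hφ : ContDiff ℝ 2 φ) {C L R P : ℝ} (hP : 0 < P)
    (hu : ∀ z v : E, fderiv ℝ (fderiv ℝ φ) z v v +
      fderiv ℝ (fderiv ℝ φ) z (Complex.I • v) (Complex.I • v) ≤ 4 * C * ‖v‖ ^ 2)
    (hC : 0 ≤ C) {F : E → ℂ} (hF : Differentiable ℂ F) {η : ℂ → E} (hR : 1 < R)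
    (hη : DifferentiableOn ℂ η (ball 0 R)) (hL : ∀ z ∈ ball (0 : ℂ) R, ‖deriv η z‖ ≤ L) :
    density P φ F (η 0) ≤ ENNReal.ofReal (Real.exp (P * (C * L ^ 2)) * (2 * Real.pi)⁻¹) *
      ∫⁻ θ in Ioc 0 (2 * Real.pi), density P φ F (η (Complex.exp (θ * Complex.I))) := by
  have hsub : closedBall (0 : ℂ) 1 ⊆ ball 0 R := closedBall_subset_ball hR
  have hg : AnalyticOnNhd ℂ (F ∘ η) (closedBall 0 1) :=
    ((hF.comp_differentiableOn hη).analyticOnNhd isOpen_ball).mono hsub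
  have hψ : ContinuousOn (φ ∘ η) (sphere 0 1) :=
    hφ.continuous.comp_continuousOn (hη.continuousOn.mono (sphere_subset_closedBall.trans hsub))
  have key := norm_rpow_mul_exp_le_circleAverage one_pos hP hg hψ
    (circleAverage_comp_le_add hφ hu hC hR hη hL)
  have hcm : ∀ θ : ℝ, circleMap 0 1 θ = Complex.exp (θ * Complex.I) := fun θ ↦ by simp [circleMap]
  simp only [Real.circleAverage_def, smul_eq_mul, Function.comp_apply, hcm] at key
  rw [intervalIntegral.integral_of_le Real.two_pi_pos.le, ← mul_assoc] at key
  unfold density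
  refine (ENNReal.ofReal_le_ofReal key).trans_eq ?_
  rw [ENNReal.ofReal_mul (by positivity), ofReal_integral_eq_lintegral_ofReal]
  · have hgc : Continuous fun θ : ℝ ↦ ‖F (η (Complex.exp (θ * Complex.I)))‖ ^ P *
        Real.exp (-(P * φ (η (Complex.exp (θ * Complex.I))))) := by
      have hηc : Continuous fun θ : ℝ ↦ η (Complex.exp (θ * Complex.I)) := by
        refine hη.continuousOn.comp_continuous (by fun_prop) fun θ ↦ ?_
        simpa [Complex.norm_exp_ofReal_mul_I] using hR
      exact (((hF.continuous.comp hηc).norm.rpow_const fun _ ↦ .inr hP.le)).mul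
        (continuous_const.mul (hφ.continuous.comp hηc)).neg.rexp
    exact hgc.integrableOn_Ioc
  · exact .of_forall fun θ ↦ by positivity

theorem mul_measure_ball_le_lintegral {E : Type*} [NormedAddCommGroup E] [NormedSpace ℂ E]
    [MeasurableSpace E] [BorelSpace E] [SecondCountableTopology E] {μ : Measure E} [SFinite μ]
    (hμ : ∀ c : ℂ, ‖c‖ = 1 → MeasurePreserving (fun q : E ↦ c • q) μ μ) {v : E → ℝ≥0∞}
    (hv : Measurable v) {ρ : ℝ} {a : ℝ≥0∞}
    (ha : ∀ q ∈ ball (0 : E) ρ,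
      a ≤ ∫⁻ θ in Ioc 0 (2 * Real.pi), v (Complex.exp (θ * Complex.I) • q)) :
    a * μ (ball 0 ρ) ≤ ENNReal.ofReal (2 * Real.pi) * ∫⁻ q in ball 0 ρ, v q ∂μ := by
  have hrot : ∀ θ : ℝ, ∫⁻ q in ball (0 : E) ρ, v (Complex.exp (θ * Complex.I) • q) ∂μ =
      ∫⁻ q in ball (0 : E) ρ, v q ∂μ := fun θ ↦ by
    have hn := Complex.norm_exp_ofReal_mul_I θ
    have := (hμ _ hn).setLIntegral_comp_preimage (s := ball 0 ρ) measurableSet_ball hv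
    rw [← this]
    congr 2
    ext q
    simp [norm_smul, hn]
  calc a * μ (ball 0 ρ) = ∫⁻ _ in ball (0 : E) ρ, a ∂μ := by rw [setLIntegral_const]
    _ ≤ ∫⁻ q in ball (0 : E) ρ, ∫⁻ θ in Ioc 0 (2 * Real.pi),
          v (Complex.exp (θ * Complex.I) • q) ∂volume ∂μ := setLIntegral_mono' measurableSet_ball ha
    _ = ∫⁻ θ in Ioc 0 (2 * Real.pi), ∫⁻ q in ball (0 : E) ρ,
          v (Complex.exp (θ * Complex.I) • q) ∂μ ∂volume := by
        refine lintegral_lintegral_swap (Measurable.aemeasurable ?_)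
        refine hv.comp (Continuous.measurable ?_)
        fun_prop
    _ = _ := by
        simp only [hrot, setLIntegral_const, Real.volume_Ioc, sub_zero]
        rw [mul_comm]

instance isAddHaarMeasure_vol (n : ℕ) : (vol n).IsAddHaarMeasure := by
  have h : Module.finrank ℝ (En n) = 2 * n := by
    rw [finrank_real_of_complex, finrank_euclideanSpace_fin]
  have : vol n = μH[(Module.finrank ℝ (En n) : ℝ)] := by
    rw [h, vol]; push_cast; rfl
  rw [this]
  exact isAddHaarMeasure_hausdorffMeasure

theorem measurePreserving_smul_vol (n : ℕ) (c : ℂ) (hc : ‖c‖ = 1) :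
    MeasurePreserving (fun q : En n ↦ c • q) (vol n) (vol n) := by
  have hc0 : c ≠ 0 := fun h ↦ by simp [h] at hc
  let e : En n ≃ᵢ En n := IsometryEquiv.mk' (fun q ↦ c • q) (fun q ↦ c⁻¹ • q)
    (fun q ↦ by simp [smul_smul, hc0])
    (Isometry.of_dist_eq fun x y ↦ by rw [dist_smul₀, hc, one_mul])
  exact e.measurePreserving_hausdorffMeasure _

theorem isOpen_setOf_infDist_lt {E : Type*} [PseudoMetricSpace E] (W : Set E) (ε : ℝ) :
    IsOpen {z : E | infDist z W < ε} :=
  isOpen_lt (continuous_infDist_pt W) continuous_const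

section Reach

variable {E : Type*} [NormedAddCommGroup E] [InnerProductSpace ℝ E] {W : Set E} {ε : ℝ}
  {pr : E → E}

open scoped RealInnerProductSpace

/-- `pr` is a differentiable nearest-point projection onto `W` on the `ε`-neighborhood of `W`. -/
structure IsSmoothProj (W : Set E) (ε : ℝ) (pr : E → E) : Prop where
  pos : 0 < ε
  contDiffOn : ContDiffOn ℝ 1 pr {z | infDist z W < ε}
  mem : ∀ z, infDist z W < ε → pr z ∈ W
  dist_eq : ∀ z, infDist z W < ε → dist z (pr z) = infDist z W

namespace IsSmoothProj

theorem infDist_lt (h : IsSmoothProj W ε pr) {x : E} (hx : x ∈ W) : infDist x W < ε := by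
  rw [infDist_zero_of_mem hx]; exact h.pos

theorem apply_of_mem (h : IsSmoothProj W ε pr) {x : E} (hx : x ∈ W) : pr x = x := by
  have := h.dist_eq x (h.infDist_lt hx)
  rw [infDist_zero_of_mem hx, dist_eq_zero] at this
  exact this.symm

theorem hasFDerivAt (h : IsSmoothProj W ε pr) {z : E} (hz : infDist z W < ε) :
    HasFDerivAt pr (fderiv ℝ pr z) z :=
  ((h.contDiffOn.differentiableOn (by norm_num)).differentiableAt
    ((isOpen_setOf_infDist_lt W ε).mem_nhds hz)).hasFDerivAt

theorem norm_sub_le (h : IsSmoothProj W ε pr) {z y : E} (hz : infDist z W < ε) (hy : y ∈ W) :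
    ‖z - pr z‖ ≤ ‖z - y‖ := by
  rw [← dist_eq_norm, ← dist_eq_norm, h.dist_eq z hz]
  exact infDist_le_dist_of_mem hy

theorem inner_sub_fderiv (h : IsSmoothProj W ε pr) {z : E} (hz : infDist z W < ε) (v : E) :
    ⟪z - pr z, fderiv ℝ pr z v⟫ = 0 := by
  have hmin : IsLocalMin (fun y ↦ ‖y - pr z‖ ^ 2 - ‖y - pr y‖ ^ 2) z := by
    filter_upwards [(isOpen_setOf_infDist_lt W ε).mem_nhds hz] with y hy
    have := pow_le_pow_left₀ (norm_nonneg _) (h.norm_sub_le hy (h.mem z hz)) 2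
    linarith
  have hd := (((hasFDerivAt_id z).sub_const (pr z)).norm_sq).sub
    (((hasFDerivAt_id z).sub (h.hasFDerivAt hz)).norm_sq)
  have := congrArg (fun L : E →L[ℝ] ℝ ↦ L v) (hmin.hasFDerivAt_eq_zero hd)
  simp at this
  rw [inner_sub_left]; linarith

theorem inner_fderiv_symm (h : IsSmoothProj W ε pr) {z : E} (hz : infDist z W < ε) (v w : E) :
    ⟪fderiv ℝ pr z v, w⟫ = ⟪fderiv ℝ pr z w, v⟫ := by
  let B : E →L[ℝ] E →L[ℝ] ℝ := innerSL ℝ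
  have hB : ∀ a b, B a b = ⟪a, b⟫ := fun a b ↦ rfl
  have h1 : ∀ᶠ y in 𝓝 z, HasFDerivAt (fun y ↦ ‖y - pr y‖ ^ 2) (B ((2 : ℝ) • (y - pr y))) y := by
    filter_upwards [(isOpen_setOf_infDist_lt W ε).mem_nhds hz] with y hy
    refine ((hasFDerivAt_id y).sub (h.hasFDerivAt hy)).norm_sq.congr_fderiv ?_
    ext v
    have := h.inner_sub_fderiv hy v
    have e1 : B ((2 : ℝ) • (y - pr y)) v = 2 * ⟪y - pr y, v⟫ := by
      rw [map_smul, smul_apply, hB, smul_eq_mul]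
    rw [e1]
    simp [inner_sub_left] at this ⊢
    linarith
  have h2 : HasFDerivAt (fun y ↦ B ((2 : ℝ) • (y - pr y))) _ z :=
    B.hasFDerivAt.comp z (((hasFDerivAt_id z).sub (h.hasFDerivAt hz)).const_smul (2 : ℝ))
  have := second_derivative_symmetric_of_eventually h1 h2 v w
  simp [hB, real_inner_comm v w] at this
  linarith

theorem fderiv_sub_eq_zero (h : IsSmoothProj W ε pr) {z : E} (hz : infDist z W < ε) :
    fderiv ℝ pr z (z - pr z) = 0 := by
  rw [← inner_self_eq_zero (𝕜 := ℝ), h.inner_fderiv_symm hz, real_inner_comm,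
    h.inner_sub_fderiv hz]

/-- The projection is constant along normal rays, up to distance `ε`. -/
theorem apply_add_smul (h : IsSmoothProj W ε pr) {x ν : E} (hx : x ∈ W) (hν : ‖ν‖ = 1)
    {t₀ t : ℝ} (ht₀ : 0 < t₀) (hpr : pr (x + t₀ • ν) = x) (ht : t₀ ≤ t) (htε : t < ε) :
    pr (x + t • ν) = x := by
  have hU : ∀ s ∈ Icc t₀ t, infDist (x + s • ν) W < ε := fun s hs ↦ by
    refine (infDist_le_dist_of_mem hx).trans_lt ?_
    rw [dist_eq_norm, add_sub_cancel_left, norm_smul, hν, mul_one, Real.norm_of_nonneg]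
    · exact hs.2.trans_lt htε
    · exact ht₀.le.trans hs.1
  have hγ : ∀ s : ℝ, HasDerivAt (fun s : ℝ ↦ x + s • ν) ν s := fun s ↦ by
    simpa using ((hasDerivAt_id s).smul_const ν).const_add x
  have hγc : Continuous fun s : ℝ ↦ x + s • ν := by fun_prop
  have hDc : ContinuousOn (fun s : ℝ ↦ fderiv ℝ pr (x + s • ν)) (Icc t₀ t) :=
    (h.contDiffOn.continuousOn_fderiv_of_isOpen (isOpen_setOf_infDist_lt W ε) le_rfl).comp hγc.continuousOn hU
  obtain ⟨K, hK⟩ := isCompact_Icc.exists_bound_of_continuousOn hDc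
  have hd : ∀ s ∈ Icc t₀ t, HasDerivAt (fun s : ℝ ↦ pr (x + s • ν) - x)
      (fderiv ℝ pr (x + s • ν) ν) s := fun s hs ↦
    ((h.hasFDerivAt (hU s hs)).comp_hasDerivAt s (hγ s)).sub_const x
  have := eq_zero_of_abs_deriv_le_mul_abs_self_of_eq_zero_right (K := K / t₀)
    (f := fun s : ℝ ↦ pr (x + s • ν) - x) (f' := fun s ↦ fderiv ℝ pr (x + s • ν) ν)
    (a := t₀) (b := t) (fun s hs ↦ (hd s hs).continuousAt.continuousWithinAt)
    (fun s hs ↦ (hd s (Ico_subset_Icc_self hs)).hasDerivWithinAt) (by simp [hpr]) ?_ t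
    (right_mem_Icc.2 ht)
  · exact sub_eq_zero.1 this
  intro s hs
  have hs' := Ico_subset_Icc_self hs
  have hs0 : 0 < s := ht₀.trans_le hs.1
  have hz := h.fderiv_sub_eq_zero (hU s hs')
  have he : x + s • ν - pr (x + s • ν) = s • ν - (pr (x + s • ν) - x) := by abel
  rw [he, map_sub, map_smul, sub_eq_zero] at hz
  have hn : s * ‖fderiv ℝ pr (x + s • ν) ν‖ ≤ K * ‖pr (x + s • ν) - x‖ := by
    rw [← Real.norm_of_nonneg hs0.le, ← norm_smul, Real.norm_of_nonneg hs0.le, hz]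
    exact ContinuousLinearMap.le_of_opNorm_le _ (hK s hs') _
  rw [div_mul_eq_mul_div, le_div_iff₀ ht₀]
  refine le_trans ?_ hn
  rw [mul_comm]
  exact mul_le_mul_of_nonneg_right hs.1 (norm_nonneg _)

theorem inner_sub_le (h : IsSmoothProj W ε pr) {z y : E} (hz : infDist z W < ε) (hy : y ∈ W) :
    2 * ε * ⟪z - pr z, y - pr z⟫ ≤ ‖z - pr z‖ * ‖y - pr z‖ ^ 2 := by
  by_cases h0 : z - pr z = 0
  · simp [h0]
  set x := pr z with hx
  have hxW : x ∈ W := h.mem z hz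
  set t₀ := ‖z - x‖ with ht₀
  have hpos : 0 < t₀ := norm_pos_iff.2 h0
  set ν := t₀⁻¹ • (z - x) with hν
  have hνn : ‖ν‖ = 1 := by
    rw [hν, norm_smul, norm_inv, Real.norm_of_nonneg hpos.le, inv_mul_cancel₀ hpos.ne']
  have hzν : z - x = t₀ • ν := by rw [hν, smul_inv_smul₀ hpos.ne']
  have hzx : x + t₀ • ν = z := by rw [← hzν]; abel
  have ht₀ε : t₀ < ε := by rw [ht₀, ← dist_eq_norm, h.dist_eq z hz]; exact hz
  have key : ∀ t ∈ Ico t₀ ε, 2 * t * ⟪ν, y - x⟫ ≤ ‖y - x‖ ^ 2 := fun t ht ↦ by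
    have ht0 : 0 < t := hpos.trans_le ht.1
    have hp := h.apply_add_smul hxW hνn hpos (by rw [hzx]) ht.1 ht.2
    have hU : infDist (x + t • ν) W < ε := by
      refine (infDist_le_dist_of_mem hxW).trans_lt ?_
      rw [dist_eq_norm, add_sub_cancel_left, norm_smul, hνn, mul_one, Real.norm_of_nonneg ht0.le]
      exact ht.2
    have hle := pow_le_pow_left₀ (norm_nonneg _) (h.norm_sub_le hU hy) 2
    rw [hp, add_sub_cancel_left, show x + t • ν - y = t • ν - (y - x) by abel,
      norm_sub_sq_real, inner_smul_left] at hle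
    simp at hle
    linarith
  have hlim : 2 * ε * ⟪ν, y - x⟫ ≤ ‖y - x‖ ^ 2 := by
    have hcont : Filter.Tendsto (fun t : ℝ ↦ 2 * t * ⟪ν, y - x⟫) (𝓝[<] ε)
        (𝓝 (2 * ε * ⟪ν, y - x⟫)) :=
      (Continuous.tendsto (by fun_prop) ε).mono_left nhdsWithin_le_nhds
    refine le_of_tendsto hcont ?_
    filter_upwards [Ico_mem_nhdsLT ht₀ε] with t ht using key t ht
  rw [hzν, inner_smul_left]
  simp only [conj_trivial]
  nlinarith

theorem inner_le_of_fderiv_eq_zero (h : IsSmoothProj W ε pr) {x y v : E} (hx : x ∈ W)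
    (hy : y ∈ W) (hv : fderiv ℝ pr x v = 0) :
    2 * ε * ⟪v, y - x⟫ ≤ ‖v‖ * ‖y - x‖ ^ 2 := by
  have hγ : HasDerivAt (fun s : ℝ ↦ x + s • v) v 0 := by
    simpa using ((hasDerivAt_id (0 : ℝ)).smul_const v).const_add x
  have hx0 : x + (0 : ℝ) • v = x := by simp
  have hU : infDist (x + (0 : ℝ) • v) W < ε := by rw [hx0]; exact h.infDist_lt hx
  have hd : HasDerivAt (fun s : ℝ ↦ pr (x + s • v)) 0 0 := by
    have := (h.hasFDerivAt hU).comp_hasDerivAt (0 : ℝ) hγ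
    rwa [hx0, hv] at this
  have hN : Filter.Tendsto (fun s : ℝ ↦ s⁻¹ • (x + s • v - pr (x + s • v))) (𝓝[>] 0) (𝓝 v) := by
    have := (hγ.sub hd).tendsto_slope_zero_right
    simpa [h.apply_of_mem hx] using this
  have hp : Filter.Tendsto (fun s : ℝ ↦ pr (x + s • v)) (𝓝[>] 0) (𝓝 x) := by
    have := hd.continuousAt.tendsto
    rw [hx0, h.apply_of_mem hx] at this
    exact this.mono_left nhdsWithin_le_nhds
  have hyp : Filter.Tendsto (fun s : ℝ ↦ y - pr (x + s • v)) (𝓝[>] 0) (𝓝 (y - x)) :=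
    hp.const_sub y
  refine le_of_tendsto_of_tendsto ((hN.inner hyp).const_mul (2 * ε))
    (hN.norm.mul (hyp.norm.pow 2)) ?_
  have hnear : ∀ᶠ s : ℝ in 𝓝[>] 0, infDist (x + s • v) W < ε := by
    have : ContinuousAt (fun s : ℝ ↦ infDist (x + s • v) W) 0 :=
      (continuous_infDist_pt W).continuousAt.comp hγ.continuousAt
    exact (this.tendsto.mono_left nhdsWithin_le_nhds).eventually_lt_const hU
  filter_upwards [hnear, self_mem_nhdsWithin] with s hs hs0
  have := h.inner_sub_le hs hy
  have hs0' : (0 : ℝ) < s⁻¹ := inv_pos.2 hs0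
  rw [inner_smul_left, norm_smul, Real.norm_of_nonneg hs0'.le]
  simp only [conj_trivial]
  nlinarith

end IsSmoothProj

end Reach

section Tangent

open scoped InnerProductSpace

/-- `ν` is a unit normal field along the hypersurface `T = 0`, which has curvature at most `δ` in
the sense that it deviates at most quadratically from its tangent planes. -/
structure IsNormalField {E : Type*} [NormedAddCommGroup E] [InnerProductSpace ℂ E]
    (T : E → ℂ) (δ : ℝ) (ν : E → E) : Prop where
  pos : 0 < δ
  differentiable : Differentiable ℂ T
  norm_eq : ∀ x, T x = 0 → ‖ν x‖ = 1
  inner_le : ∀ x y, T x = 0 → T y = 0 → ‖⟪ν x, y - x⟫_ℂ‖ ≤ δ * ‖y - x‖ ^ 2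
  fderiv_eq : ∀ x, T x = 0 → ∃ a ≠ 0, ∀ v, fderiv ℂ T x v = a * ⟪ν x, v⟫_ℂ

variable {E : Type*} [NormedAddCommGroup E] [InnerProductSpace ℂ E]

theorem norm_le_norm_add_smul_of_inner_eq_zero {n p : E} (h : ⟪n, p⟫_ℂ = 0) (s : ℂ) :
    ‖p‖ ≤ ‖p + s • n‖ := by
  by_cases hp : p = 0
  · simp [hp]
  have h1 : ⟪p, p + s • n⟫_ℂ = (‖p‖ : ℂ) ^ 2 := by
    rw [inner_add_right, inner_smul_right, inner_eq_zero_symm.1 h, mul_zero, add_zero,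
      inner_self_eq_norm_sq_to_K]
    rfl
  have h2 := norm_inner_le_norm (𝕜 := ℂ) p (p + s • n)
  rw [h1, norm_pow, Complex.norm_real, norm_norm, sq] at h2
  exact le_of_mul_le_mul_left h2 (norm_pos_iff.2 hp)

/-- Persistence of zeros of a continuous family of holomorphic functions on a disc which do not
vanish on the boundary circle. -/
theorem eventually_exists_zero {X : Type*} [TopologicalSpace X] {g : X → ℂ → ℂ} {r : ℝ}
    (hr : 0 < r)
    (hg : Continuous (Function.uncurry g)) (hd : ∀ t, Differentiable ℂ (g t)) {t₀ : X} {ζ₀ : ℂ}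
    (hζ₀ : ζ₀ ∈ ball (0 : ℂ) r) (h0 : g t₀ ζ₀ = 0) (hs : ∀ ζ ∈ sphere (0 : ℂ) r, g t₀ ζ ≠ 0) :
    ∀ᶠ t in 𝓝 t₀, ∃ ζ ∈ closedBall (0 : ℂ) r, g t ζ = 0 := by
  have hc : ∀ t, Continuous (g t) := fun t ↦ (hd t).continuous
  obtain ⟨z, hz, hmin⟩ := (isCompact_sphere (0 : ℂ) r).exists_isMinOn
    (NormedSpace.sphere_nonempty.2 hr.le) (hc t₀).norm.continuousOn
  set m := ‖g t₀ z‖ with hm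
  have hmpos : 0 < m := norm_pos_iff.2 (hs z hz)
  have h1 : ∀ᶠ t in 𝓝 t₀, ∀ ζ ∈ sphere (0 : ℂ) r, m / 2 < ‖g t ζ‖ := by
    refine (isCompact_sphere (0 : ℂ) r).eventually_forall_of_forall_eventually fun ζ hζ ↦ ?_
    refine (hg.norm.tendsto (t₀, ζ)).eventually_const_lt ?_
    have : m ≤ ‖g t₀ ζ‖ := hmin hζ
    simp only [Function.uncurry_apply_pair]
    linarith
  have h2 : ∀ᶠ t in 𝓝 t₀, ‖g t ζ₀‖ < m / 2 := by
    have : Continuous fun t ↦ ‖g t ζ₀‖ := (hg.comp (by fun_prop : Continuous fun t ↦ (t, ζ₀))).norm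
    refine (this.tendsto t₀).eventually_lt_const ?_
    rw [h0, norm_zero]; linarith
  filter_upwards [h1, h2] with t ht1 ht2
  by_contra! hne
  have hdc : DiffContOnCl ℂ (fun ζ ↦ (g t ζ)⁻¹) (ball 0 r) := by
    refine DifferentiableOn.diffContOnCl ?_
    rw [closure_ball _ hr.ne']
    exact (hd t).differentiableOn.fun_inv hne
  have hle := Complex.norm_le_of_forall_mem_frontier_norm_le isBounded_ball hdc (C := (m / 2)⁻¹)
    (fun ζ hζ ↦ by
      rw [frontier_ball _ hr.ne'] at hζ
      rw [norm_inv]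
      exact inv_anti₀ (by linarith) (ht1 ζ hζ).le) (subset_closure hζ₀)
  rw [norm_inv] at hle
  have hpos : 0 < ‖g t ζ₀‖ := norm_pos_iff.2 (hne ζ₀ (ball_subset_closedBall hζ₀))
  exact absurd ((inv_le_inv₀ hpos (by linarith)).1 hle) (by linarith)

namespace IsNormalField

variable {T : E → ℂ} {δ : ℝ} {ν : E → E} {x y : E} {r : ℝ}

theorem inner_self (h : IsNormalField T δ ν) (hx : T x = 0) : ⟪ν x, ν x⟫_ℂ = 1 := by
  rw [inner_self_eq_norm_sq_to_K, h.norm_eq x hx]; simp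

theorem inner_add_smul (h : IsNormalField T δ ν) (hx : T x = 0) {p : E} (hp : ⟪ν x, p⟫_ℂ = 0)
    (ζ : ℂ) : ⟪ν x, p + ζ • ν x⟫_ℂ = ζ := by
  rw [inner_add_right, hp, inner_smul_right, h.inner_self hx, zero_add, mul_one]

theorem norm_le_of_apply_eq_zero (h : IsNormalField T δ ν) (hx : T x = 0) (hδ : 48 * δ * r ≤ 1)
    {p : E} (hp : ⟪ν x, p⟫_ℂ = 0) {ζ : ℂ} (hζ : ‖ζ‖ ≤ r) (h0 : T (x + p + ζ • ν x) = 0) :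
    ‖ζ‖ ≤ 2 * δ * ‖p‖ ^ 2 := by
  have h1 := h.inner_le x _ hx h0
  rw [show x + p + ζ • ν x - x = p + ζ • ν x by abel, h.inner_add_smul hx hp] at h1
  have h2 : ‖p + ζ • ν x‖ ^ 2 ≤ ‖p‖ ^ 2 + ‖ζ‖ ^ 2 := by
    rw [@norm_add_sq ℂ, inner_smul_right, inner_eq_zero_symm.1 hp, norm_smul, h.norm_eq x hx]
    simp
  have h3 := mul_le_mul_of_nonneg_left h2 h.pos.le
  have h4 : δ * ‖ζ‖ ^ 2 ≤ δ * r * ‖ζ‖ := by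
    have := mul_le_mul_of_nonneg_left (mul_le_mul_of_nonneg_left hζ (norm_nonneg ζ)) h.pos.le
    linarith
  have h5 : δ * r * ‖ζ‖ ≤ 1 / 2 * ‖ζ‖ :=
    mul_le_mul_of_nonneg_right (by linarith) (norm_nonneg ζ)
  linarith

theorem exists_apply_eq_zero (h : IsNormalField T δ ν) (hx : T x = 0) (hr : 0 < r)
    (hδ : 48 * δ * r ≤ 1) {p : E} (hp : ⟪ν x, p⟫_ℂ = 0) (hpr : ‖p‖ ≤ r) :
    ∃ ζ : ℂ, ‖ζ‖ ≤ 2 * δ * ‖p‖ ^ 2 ∧ T (x + p + ζ • ν x) = 0 := by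
  let g : ℝ → ℂ → ℂ := fun t ζ ↦ T (x + (t : ℂ) • p + ζ • ν x)
  have hg : Continuous (Function.uncurry g) := by
    have := h.differentiable.continuous
    simp only [g, Function.uncurry_def]
    fun_prop
  have hd : ∀ t, Differentiable ℂ (g t) := fun t ↦ h.differentiable.comp (by fun_prop)
  have hpt : ∀ t : ℝ, ⟪ν x, (t : ℂ) • p⟫_ℂ = 0 := fun t ↦ by rw [inner_smul_right, hp, mul_zero]
  have hlt : ∀ t ∈ Icc (0 : ℝ) 1, ∀ ζ : ℂ, ‖ζ‖ ≤ r → g t ζ = 0 → ‖ζ‖ < r := by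
    intro t ht ζ hζ h0
    have h1 := h.norm_le_of_apply_eq_zero hx hδ (hpt t) hζ h0
    have h2 : ‖(t : ℂ) • p‖ ≤ r := by
      rw [norm_smul, Complex.norm_real, Real.norm_of_nonneg ht.1]
      exact (mul_le_of_le_one_left (norm_nonneg _) ht.2).trans hpr
    have h3 : 2 * δ * ‖(t : ℂ) • p‖ ^ 2 ≤ 2 * δ * r ^ 2 := by
      have := h.pos; gcongr
    nlinarith
  set A : Set ℝ := {t | ∃ ζ ∈ closedBall (0 : ℂ) r, g t ζ = 0} with hA
  have hAc : IsClosed A := by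
    have hcl : A = Prod.fst '' {q : ℝ × closedBall (0 : ℂ) r | g q.1 q.2 = 0} := by
      ext t; simp [hA]
    rw [hcl]
    have : CompactSpace (closedBall (0 : ℂ) r) :=
      isCompact_iff_compactSpace.1 (isCompact_closedBall _ _)
    refine isClosedMap_fst_of_compactSpace _ ?_
    exact isClosed_eq (hg.comp (by fun_prop : Continuous fun q : ℝ × closedBall (0 : ℂ) r ↦
      (q.1, (q.2 : ℂ)))) continuous_const
  have hsub : Icc (0 : ℝ) 1 ⊆ A := by
    refine IsClosed.Icc_subset_of_forall_mem_nhdsWithin (hAc.inter isClosed_Icc) ?_ ?_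
    · exact ⟨0, by simp [hr.le], by simp [g, hx]⟩
    · rintro t ⟨⟨ζ, hζ, h0⟩, ht⟩
      have ht' := Ico_subset_Icc_self ht
      refine nhdsWithin_le_nhds (eventually_exists_zero hr hg hd (ζ₀ := ζ) ?_ h0 ?_)
      · simpa using hlt t ht' ζ (by simpa using hζ) h0
      · intro z hz hz0
        have hz' : ‖z‖ = r := by simpa using hz
        exact (hlt t ht' z hz'.le hz0).ne hz'
  obtain ⟨ζ, hζ, h0⟩ := hsub (right_mem_Icc.2 zero_le_one)
  have h0' : T (x + p + ζ • ν x) = 0 := by simpa [g] using h0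
  exact ⟨ζ, h.norm_le_of_apply_eq_zero hx hδ hp (by simpa using hζ) h0', h0'⟩

theorem norm_inner_le_of_tangent (h : IsNormalField T δ ν) (hx : T x = 0) (hy : T y = 0)
    (hr : 0 < r) (hδ : 48 * δ * r ≤ 1) (hxy : ‖y - x‖ ≤ r) {u : E} (hu : ⟪ν y, u⟫_ℂ = 0) :
    ‖⟪ν x, u⟫_ℂ‖ ≤ 1 / 4 * ‖u‖ := by
  by_cases hu0 : u = 0
  · simp [hu0]
  have hupos : 0 < ‖u‖ := norm_pos_iff.2 hu0
  wlog hur : ‖u‖ = r generalizing u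
  · set s : ℂ := ((r / ‖u‖ : ℝ) : ℂ) with hs
    have hsn : ‖s‖ = r / ‖u‖ := by
      rw [hs, Complex.norm_real, Real.norm_of_nonneg (by positivity)]
    have hsp : 0 < ‖s‖ := by rw [hsn]; positivity
    have hn : ‖s • u‖ = r := by rw [norm_smul, hsn, div_mul_cancel₀ _ hupos.ne']
    have := this (u := s • u) (by rw [inner_smul_right, hu, mul_zero])
      (norm_pos_iff.1 (hn ▸ hr)) (hn ▸ hr) hn
    rw [inner_smul_right, norm_mul, norm_smul] at this
    refine le_of_mul_le_mul_left ?_ hsp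
    linarith
  obtain ⟨ζ, hζ, h0⟩ := h.exists_apply_eq_zero hy hr hδ hu hur.le
  rw [hur] at hζ ⊢
  have hδ0 := h.pos
  have hζν : ‖ζ • ν y‖ ≤ 2 * δ * r ^ 2 := by rw [norm_smul, h.norm_eq y hy, mul_one]; exact hζ
  have hδr : 48 * (δ * r ^ 2) ≤ r := by nlinarith
  have e1 : y + u + ζ • ν y - x = (y - x) + u + ζ • ν y := by abel
  have hn1 : ‖y + u + ζ • ν y - x‖ ≤ 3 * r := by
    rw [e1]
    have h1 := norm_add_le ((y - x) + u) (ζ • ν y)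
    have h2 := norm_add_le (y - x) u
    linarith
  have h1 := h.inner_le x _ hx h0
  have h2 := h.inner_le x y hx hy
  have h1' : δ * ‖y + u + ζ • ν y - x‖ ^ 2 ≤ δ * (3 * r) ^ 2 := by gcongr
  have h2' : δ * ‖y - x‖ ^ 2 ≤ δ * r ^ 2 := by gcongr
  have h3 : ‖⟪ν x, ζ • ν y⟫_ℂ‖ ≤ 2 * δ * r ^ 2 := by
    refine (norm_inner_le_norm _ _).trans ?_
    rw [h.norm_eq x hx, one_mul]; exact hζν
  have e2 : ⟪ν x, u⟫_ℂ = ⟪ν x, y + u + ζ • ν y - x⟫_ℂ - ⟪ν x, y - x⟫_ℂ - ⟪ν x, ζ • ν y⟫_ℂ := by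
    rw [e1, inner_add_right, inner_add_right]; ring
  rw [e2]
  have h4 := norm_sub_le (⟪ν x, y + u + ζ • ν y - x⟫_ℂ - ⟪ν x, y - x⟫_ℂ) ⟪ν x, ζ • ν y⟫_ℂ
  have h5 := norm_sub_le ⟪ν x, y + u + ζ • ν y - x⟫_ℂ ⟪ν x, y - x⟫_ℂ
  linarith

theorem inner_ne_zero (h : IsNormalField T δ ν) (hx : T x = 0) (hy : T y = 0)
    (hr : 0 < r) (hδ : 48 * δ * r ≤ 1) (hxy : ‖y - x‖ ≤ r) : ⟪ν y, ν x⟫_ℂ ≠ 0 := fun h0 ↦ by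
  have := h.norm_inner_le_of_tangent hx hy hr hδ hxy h0
  rw [h.inner_self hx, h.norm_eq x hx] at this
  norm_num at this

theorem norm_inner_sub_le (h : IsNormalField T δ ν) (hx : T x = 0) (hr : 0 < r)
    (hδ : 48 * δ * r ≤ 1) {z : E} (hy : T y = 0) (hz : T z = 0) (hyx : ‖y - x‖ ≤ r)
    (hzx : ‖z - x‖ ≤ r) : ‖⟪ν x, z - y⟫_ℂ‖ ≤ 1 / 2 * ‖z - y‖ := by
  set s := ⟪ν y, z - y⟫_ℂ with hs
  have hu : ⟪ν y, z - y - s • ν y⟫_ℂ = 0 := by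
    rw [inner_sub_right, inner_smul_right, h.inner_self hy, mul_one, sub_self]
  have h1 := h.norm_inner_le_of_tangent hx hy hr hδ hyx hu
  have h2 : ‖z - y - s • ν y‖ ≤ ‖z - y‖ := by
    simpa using norm_le_norm_add_smul_of_inner_eq_zero hu s
  have h3 : ‖⟪ν x, s • ν y⟫_ℂ‖ ≤ δ * ‖z - y‖ ^ 2 := by
    refine (norm_inner_le_norm _ _).trans ?_
    rw [h.norm_eq x hx, one_mul, norm_smul, h.norm_eq y hy, mul_one]
    exact h.inner_le y z hy hz
  have h4 : ‖z - y‖ ≤ 2 * r := by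
    have := norm_sub_le (z - x) (y - x)
    rw [sub_sub_sub_cancel_right] at this
    linarith
  have h5 : δ * ‖z - y‖ ^ 2 ≤ 1 / 4 * ‖z - y‖ := by
    have := mul_le_mul_of_nonneg_left h4 h.pos.le
    have : δ * ‖z - y‖ ≤ 1 / 4 := by linarith
    nlinarith [norm_nonneg (z - y)]
  have e : ⟪ν x, z - y⟫_ℂ = ⟪ν x, z - y - s • ν y⟫_ℂ + ⟪ν x, s • ν y⟫_ℂ := by
    rw [← inner_add_right, sub_add_cancel]
  rw [e]
  have := norm_add_le ⟪ν x, z - y - s • ν y⟫_ℂ ⟪ν x, s • ν y⟫_ℂ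
  linarith

/-- Near each of its points, a hypersurface with a normal field of bounded curvature is a
holomorphic graph over its tangent plane. -/
theorem exists_graph {V : Type*} [NormedAddCommGroup V] [NormedSpace ℂ V]
    (h : IsNormalField T δ ν) (hx : T x = 0) (hr : 0 < r)
    (hδ : 48 * δ * r ≤ 1) (J : V →ₗᵢ[ℂ] E) (hJ : ∀ q, ⟪ν x, J q⟫_ℂ = 0)
    (hJs : ∀ p, ⟪ν x, p⟫_ℂ = 0 → ∃ q, J q = p) :
    ∃ G : V → E, G 0 = x ∧ DifferentiableOn ℂ G (ball 0 (r / 2)) ∧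
      (∀ q ∈ ball 0 (r / 2), T (G q) = 0 ∧ G q ∈ ball x r) ∧
      (∀ q ∈ ball 0 (r / 2), ∀ q' ∈ ball 0 (r / 2),
        ‖q - q'‖ ≤ ‖G q - G q'‖ ∧ ‖G q - G q'‖ ≤ 2 * ‖q - q'‖) ∧
      ∀ y ∈ ball x (r / 2), T y = 0 → ∃ q ∈ ball 0 (r / 2), G q = y := by
  have hex : ∀ q : V, ∃ ζ : ℂ, q ∈ ball (0 : V) (r / 2) →
      ‖ζ‖ ≤ 2 * δ * ‖q‖ ^ 2 ∧ T (x + J q + ζ • ν x) = 0 := fun q ↦ by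
    by_cases hq : q ∈ ball (0 : V) (r / 2)
    · rw [mem_ball_zero_iff] at hq
      obtain ⟨ζ, hζ⟩ := h.exists_apply_eq_zero hx hr hδ (hJ q)
        (by rw [J.norm_map]; linarith)
      exact ⟨ζ, fun _ ↦ by rwa [J.norm_map] at hζ⟩
    · exact ⟨0, fun hq' ↦ absurd hq' hq⟩
  choose ζ hζ using hex
  set G : V → E := fun q ↦ x + J q + ζ q • ν x with hG
  have hδ0 := h.pos
  have hζ' : ∀ q ∈ ball (0 : V) (r / 2), ‖ζ q‖ ≤ 1 / 2 * ‖q‖ := fun q hq ↦ by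
    refine (hζ q hq).1.trans ?_
    rw [mem_ball_zero_iff] at hq
    have : δ * ‖q‖ ≤ δ * (r / 2) := by gcongr
    nlinarith [norm_nonneg q]
  have hmem : ∀ q ∈ ball (0 : V) (r / 2), T (G q) = 0 ∧ G q ∈ ball x r := fun q hq ↦ by
    refine ⟨(hζ q hq).2, ?_⟩
    rw [mem_ball_iff_norm, hG]
    simp only
    rw [show x + J q + ζ q • ν x - x = J q + ζ q • ν x by abel]
    have h1 := norm_add_le (J q) (ζ q • ν x)
    rw [J.norm_map, norm_smul, h.norm_eq x hx] at h1
    have h2 := hζ' q hq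
    rw [mem_ball_zero_iff] at hq
    linarith
  have hmemc : ∀ q ∈ ball (0 : V) (r / 2), ‖G q - x‖ ≤ r := fun q hq ↦
    (mem_ball_iff_norm.1 (hmem q hq).2).le
  have hsub : ∀ q q' : V, G q - G q' = J (q - q') + (ζ q - ζ q') • ν x := fun q q' ↦ by
    simp only [hG, map_sub, sub_smul]; abel
  have hsub' : ∀ q q' : V, ⟪ν x, G q - G q'⟫_ℂ = ζ q - ζ q' := fun q q' ↦ by
    rw [hsub, h.inner_add_smul hx (hJ _)]
  have hlow : ∀ q q' : V, ‖q - q'‖ ≤ ‖G q - G q'‖ := fun q q' ↦ by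
    rw [hsub, ← J.norm_map (q - q')]
    exact norm_le_norm_add_smul_of_inner_eq_zero (hJ _) _
  have hup : ∀ q ∈ ball (0 : V) (r / 2), ∀ q' ∈ ball (0 : V) (r / 2),
      ‖G q - G q'‖ ≤ 2 * ‖q - q'‖ := fun q hq q' hq' ↦ by
    have h1 := h.norm_inner_sub_le hx hr hδ (hmem q' hq').1 (hmem q hq).1 (hmemc q' hq')
      (hmemc q hq)
    rw [hsub'] at h1
    have h2 := norm_add_le (J (q - q')) ((ζ q - ζ q') • ν x)
    rw [← hsub, J.norm_map, norm_smul, h.norm_eq x hx] at h2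
    linarith
  refine ⟨G, ?_, ?_, hmem, fun q hq q' hq' ↦ ⟨hlow q q', hup q hq q' hq'⟩, ?_⟩
  · have := hζ' 0 (mem_ball_self (by linarith))
    have h0 : ζ 0 = 0 := by simpa using this
    simp [hG, h0]
  · intro q₀ hq₀
    obtain ⟨a, ha, hfd⟩ := h.fderiv_eq (G q₀) (hmem q₀ hq₀).1
    have hκ : fderiv ℂ T (G q₀) (ν x) ≠ 0 := by
      rw [hfd]
      exact mul_ne_zero ha (h.inner_ne_zero hx (hmem q₀ hq₀).1 hr hδ (hmemc q₀ hq₀))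
    set L := fderiv ℂ T (G q₀) with hL
    have hball : ∀ᶠ q in 𝓝 q₀, q ∈ ball (0 : V) (r / 2) := isOpen_ball.mem_nhds hq₀
    have hO : (fun q ↦ G q - G q₀) =O[𝓝 q₀] fun q ↦ q - q₀ := by
      refine Asymptotics.IsBigO.of_bound 2 ?_
      filter_upwards [hball] with q hq using hup q hq q₀ hq₀
    have hGc : Filter.Tendsto G (𝓝 q₀) (𝓝 (G q₀)) := by
      rw [tendsto_iff_norm_sub_tendsto_zero]
      refine squeeze_zero' (g := fun q ↦ 2 * ‖q - q₀‖) (.of_forall fun q ↦ norm_nonneg _) ?_ ?_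
      · filter_upwards [hball] with q hq using hup q hq q₀ hq₀
      · have : Continuous fun q : V ↦ 2 * ‖q - q₀‖ := by fun_prop
        simpa using this.tendsto q₀
    have ho : (fun q ↦ L (G q - G q₀)) =o[𝓝 q₀] fun q ↦ q - q₀ := by
      have h1 := ((h.differentiable (G q₀)).hasFDerivAt.isLittleO.comp_tendsto hGc).trans_isBigO hO
      refine h1.neg_left.congr' ?_ .rfl
      filter_upwards [hball] with q hq
      simp [(hmem q hq).1, (hmem q₀ hq₀).1, hL]
    have hζd : HasFDerivAt ζ (-(L (ν x))⁻¹ • (L ∘L J.toContinuousLinearMap)) q₀ := by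
      refine .of_isLittleO ((ho.const_mul_left (L (ν x))⁻¹).congr_left fun q ↦ ?_)
      rw [hsub, map_add, map_smul, smul_eq_mul]
      simp
      field_simp
      ring
    exact (((J.toContinuousLinearMap.hasFDerivAt.const_add x).add
      (hζd.smul_const (ν x))).differentiableAt).differentiableWithinAt
  · intro y hy hy0
    rw [mem_ball_iff_norm] at hy
    set s := ⟪ν x, y - x⟫_ℂ with hs
    have hp : ⟪ν x, y - x - s • ν x⟫_ℂ = 0 := by
      rw [inner_sub_right, inner_smul_right, h.inner_self hx, mul_one, sub_self]
    obtain ⟨q, hq⟩ := hJs _ hp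
    have hqn : ‖q‖ ≤ ‖y - x‖ := by
      rw [← J.norm_map, hq]
      simpa using norm_le_norm_add_smul_of_inner_eq_zero hp s
    have hqb : q ∈ ball (0 : V) (r / 2) := mem_ball_zero_iff.2 (hqn.trans_lt hy)
    refine ⟨q, hqb, ?_⟩
    have e : G q - y = (ζ q - s) • ν x := by
      simp only [hG, hq, sub_smul]; abel
    have h1 := h.norm_inner_sub_le hx hr hδ hy0 (hmem q hqb).1 (by linarith) (hmemc q hqb)
    rw [e, inner_smul_right, h.inner_self hx, mul_one, norm_smul, h.norm_eq x hx, mul_one] at h1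
    have h2 : ‖ζ q - s‖ = 0 := by linarith [norm_nonneg (ζ q - s)]
    rw [norm_eq_zero.1 h2, zero_smul] at e
    exact sub_eq_zero.1 e

end IsNormalField

end Tangent

theorem real_inner_eq_re_inner_En {n : ℕ} (x y : En n) :
    inner ℝ x y = (inner ℂ x y).re := by
  simp [PiLp.inner_apply, Complex.inner, Complex.re_sum]

theorem UniformlyFlat.exists_isNormalField {n : ℕ} {T : En n → ℂ} (hT : Differentiable ℂ T)
    (hdT : ∀ z, T z = 0 → fderiv ℂ T z ≠ 0) (hflat : UniformlyFlat (T ⁻¹' {0})) :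
    ∃ δ ν, IsNormalField T δ ν := by
  obtain ⟨ε, hε, pr, hs, hpr⟩ := hflat
  have h : IsSmoothProj (T ⁻¹' {0}) ε pr :=
    ⟨hε, hs.of_le (by exact_mod_cast le_top), fun z hz ↦ (hpr z hz).1, fun z hz ↦ (hpr z hz).2.1⟩
  let w : En n → En n := fun x ↦ (InnerProductSpace.toDual ℂ (En n)).symm (fderiv ℂ T x)
  have hw : ∀ x v, inner ℂ (w x) v = fderiv ℂ T x v := fun x v ↦
    InnerProductSpace.toDual_symm_apply
  have hw0 : ∀ x, T x = 0 → 0 < ‖w x‖ := fun x hx ↦ by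
    rw [norm_pos_iff]
    simpa [w] using hdT x hx
  let ν : En n → En n := fun x ↦ ((‖w x‖⁻¹ : ℝ) : ℂ) • w x
  have hνn : ∀ x, T x = 0 → ‖ν x‖ = 1 := fun x hx ↦ by
    rw [norm_smul, Complex.norm_real, Real.norm_of_nonneg (by positivity),
      inv_mul_cancel₀ (hw0 x hx).ne']
  have hνi : ∀ x v, inner ℂ (ν x) v = ((‖w x‖⁻¹ : ℝ) : ℂ) * fderiv ℂ T x v := fun x v ↦ by
    rw [inner_smul_left, hw, Complex.conj_ofReal]
  have hD : ∀ x, T x = 0 → ∀ u, fderiv ℂ T x (fderiv ℝ pr x u) = 0 := fun x hx u ↦ by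
    have hxU := h.infDist_lt hx
    have h1 : HasFDerivAt T ((fderiv ℂ T (pr x)).restrictScalars ℝ) (pr x) :=
      (hT _).hasFDerivAt.restrictScalars ℝ
    have h2 := h1.comp x (h.hasFDerivAt hxU)
    have h3 : T ∘ pr =ᶠ[𝓝 x] fun _ ↦ 0 := by
      filter_upwards [(isOpen_setOf_infDist_lt _ ε).mem_nhds hxU] with z hz using h.mem z hz
    have h4 := h2.unique ((hasFDerivAt_const (0 : ℂ) x).congr_of_eventuallyEq h3)
    rw [h.apply_of_mem hx] at h4
    exact congrArg (fun L : En n →L[ℝ] ℂ ↦ L u) h4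
  refine ⟨1 / (2 * ε), ν, by positivity, hT, hνn, fun x y hx hy ↦ ?_, fun x hx ↦
    ⟨(‖w x‖ : ℂ), by exact_mod_cast (hw0 x hx).ne', fun v ↦ ?_⟩⟩
  · set k := inner ℂ (ν x) (y - x) with hk
    have hv : fderiv ℝ pr x (k • ν x) = 0 := by
      rw [← inner_self_eq_zero (𝕜 := ℝ), h.inner_fderiv_symm (h.infDist_lt hx),
        real_inner_eq_re_inner_En, inner_smul_right, ← inner_conj_symm, hνi, hD x hx]
      simp
    have h1 := h.inner_le_of_fderiv_eq_zero hx hy hv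
    rw [real_inner_eq_re_inner_En, inner_smul_left, ← hk, norm_smul, hνn x hx, mul_one,
      ← Complex.normSq_eq_conj_mul_self, Complex.ofReal_re, Complex.normSq_eq_norm_sq] at h1
    rw [div_mul_eq_mul_div, one_mul, le_div_iff₀ (by positivity)]
    by_cases hk0 : ‖k‖ = 0
    · rw [hk0, zero_mul]; positivity
    · refine le_of_mul_le_mul_left ?_ (lt_of_le_of_ne (norm_nonneg k) (Ne.symm hk0))
      linarith
  · rw [hνi, ← mul_assoc, ← Complex.ofReal_mul, mul_inv_cancel₀ (hw0 x hx).ne']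
    simp

section Estimates

variable {m : ℕ} {T : En (m + 1) → ℂ} {δ r : ℝ} {ν : En (m + 1) → En (m + 1)}

theorem exists_linearIsometry_orthogonal {v : En (m + 1)} (hv : v ≠ 0) :
    ∃ J : En m →ₗᵢ[ℂ] En (m + 1), (∀ q, inner ℂ v (J q) = 0) ∧
      ∀ p, inner ℂ v p = 0 → ∃ q, J q = p := by
  have : Fact (Module.finrank ℂ (En (m + 1)) = m + 1) := ⟨finrank_euclideanSpace_fin⟩
  let b := OrthonormalBasis.fromOrthogonalSpanSingleton (𝕜 := ℂ) m hv
  refine ⟨(ℂ ∙ v)ᗮ.subtypeₗᵢ.comp b.repr.symm.toLinearIsometry, fun q ↦ ?_, fun p hp ↦ ?_⟩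
  · exact Submodule.mem_orthogonal_singleton_iff_inner_right.1 (b.repr.symm q).2
  · exact ⟨b.repr ⟨p, Submodule.mem_orthogonal_singleton_iff_inner_right.2 hp⟩, by simp⟩

namespace IsNormalField

/-- Near each of its points, `T = 0` is a graph over a ball of `ℂᵐ`. -/
theorem exists_chart (h : IsNormalField T δ ν) {x : En (m + 1)} (hx : T x = 0) (hr : 0 < r)
    (hδ : 48 * δ * r ≤ 1) :
    ∃ G : En m → En (m + 1), G 0 = x ∧ DifferentiableOn ℂ G (ball 0 (r / 2)) ∧
      (∀ q ∈ ball 0 (r / 2), T (G q) = 0 ∧ G q ∈ ball x r) ∧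
      (∀ q ∈ ball 0 (r / 2), ∀ q' ∈ ball 0 (r / 2),
        ‖q - q'‖ ≤ ‖G q - G q'‖ ∧ ‖G q - G q'‖ ≤ 2 * ‖q - q'‖) ∧
      ∀ y ∈ ball x (r / 2), T y = 0 → ∃ q ∈ ball 0 (r / 2), G q = y := by
  have hv : ν x ≠ 0 := fun h0 ↦ by simpa [h0] using h.norm_eq x hx
  obtain ⟨J, hJ, hJs⟩ := exists_linearIsometry_orthogonal hv
  exact h.exists_graph hx hr hδ J hJ hJs

theorem hausdorffMeasure_inter_ball_le (h : IsNormalField T δ ν) (hr : 0 < r)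
    (hδ : 48 * δ * r ≤ 1) (z : En (m + 1)) :
    μH[(2 * m : ℝ)] (ball z (r / 4) ∩ T ⁻¹' {0}) ≤
      (2 : ℝ≥0∞) ^ (2 * m : ℝ) * vol m (ball 0 (r / 2)) := by
  rcases (ball z (r / 4) ∩ T ⁻¹' {0}).eq_empty_or_nonempty with he | ⟨x, hxz, hx⟩
  · simp [he]
  obtain ⟨G, -, -, -, hGl, hGs⟩ := h.exists_chart hx hr hδ
  have hsub : ball z (r / 4) ∩ T ⁻¹' {0} ⊆ G '' ball 0 (r / 2) := by
    rintro y ⟨hyz, hy⟩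
    refine hGs y ?_ hy
    rw [mem_ball] at *
    have := dist_triangle_right y x z
    linarith
  have hlip : LipschitzOnWith 2 G (ball 0 (r / 2)) := by
    refine LipschitzOnWith.of_dist_le_mul fun q hq q' hq' ↦ ?_
    rw [dist_eq_norm, dist_eq_norm]
    exact (hGl q hq q' hq').2
  exact (measure_mono hsub).trans (hlip.hausdorffMeasure_image_le (by positivity))

end IsNormalField

theorem map_restrict_vol_le {ρ : ℝ} {G : En m → En (m + 1)}
    (hG : ContinuousOn G (ball 0 ρ)) {A : Set (En (m + 1))} (hA : MapsTo G (ball 0 ρ) A)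
    (hGl : ∀ q ∈ ball 0 ρ, ∀ q' ∈ ball 0 ρ, ‖q - q'‖ ≤ ‖G q - G q'‖) :
    ((vol m).restrict (ball 0 ρ)).map G ≤ (μH[(2 * m : ℝ)]).restrict A := by
  refine Measure.le_iff.2 fun s hs ↦ ?_
  rw [Measure.map_apply_of_aemeasurable (hG.aemeasurable measurableSet_ball) hs,
    Measure.restrict_apply₀' measurableSet_ball.nullMeasurableSet, Measure.restrict_apply hs]
  set B := G ⁻¹' s ∩ ball 0 ρ with hB
  have hinj : InjOn G B := fun q hq q' hq' hqq ↦ by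
    have := hGl q hq.2 q' hq'.2
    rw [hqq, sub_self, norm_zero] at this
    exact sub_eq_zero.1 (norm_le_zero_iff.1 this)
  have hlip : LipschitzOnWith 1 (Function.invFunOn G B) (G '' B) := by
    refine LipschitzOnWith.of_dist_le_mul ?_
    rintro _ ⟨q, hq, rfl⟩ _ ⟨q', hq', rfl⟩
    rw [hinj.leftInvOn_invFunOn hq, hinj.leftInvOn_invFunOn hq', dist_eq_norm, dist_eq_norm,
      NNReal.coe_one, one_mul]
    exact hGl q hq.2 q' hq'.2
  have hle := hlip.hausdorffMeasure_image_le (d := (2 * m : ℝ)) (by positivity)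
  rw [hinj.leftInvOn_invFunOn.image_image, ENNReal.coe_one, ENNReal.one_rpow, one_mul] at hle
  refine hle.trans (measure_mono ?_)
  rintro _ ⟨q, hq, rfl⟩
  exact ⟨hq.1, hA hq.2⟩

end Estimates

section SubMean

variable {k n m : ℕ} {φ : En n → ℝ} {C P : ℝ}

theorem density_mul_vol_ball_le (hφ : ContDiff ℝ 2 φ) (hP : 0 < P)
    (hu : ∀ z v : En n, levi φ z v ≤ C * ‖v‖ ^ 2) (hC : 0 ≤ C) {F : En n → ℂ}
    (hF : Differentiable ℂ F) {G : En k → En n} {ρ l : ℝ} (hl : 0 ≤ l)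
    (hG : DifferentiableOn ℂ G (ball 0 ρ))
    (hGl : ∀ q ∈ ball 0 ρ, ∀ q' ∈ ball 0 ρ, ‖G q - G q'‖ ≤ l * ‖q - q'‖) :
    density P φ F (G 0) * vol k (ball 0 ρ) ≤ ENNReal.ofReal (Real.exp (P * (C * (l * ρ) ^ 2))) *
      ∫⁻ q in ball 0 ρ, density P φ F (G q) ∂(vol k) := by
  classical
  set c := ENNReal.ofReal (Real.exp (P * (C * (l * ρ) ^ 2)) * (2 * Real.pi)⁻¹) with hc
  set v : En k → ℝ≥0∞ := (ball 0 ρ).piecewise (fun q ↦ density P φ F (G q)) 0 with hv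
  have hvm : Measurable v := ContinuousOn.measurable_piecewise
    ((continuous_density hP.le hφ.continuous hF.continuous).comp_continuousOn hG.continuousOn)
    continuousOn_const measurableSet_ball
  have hvball : ∀ q ∈ ball (0 : En k) ρ, v q = density P φ F (G q) := fun q hq ↦
    piecewise_eq_of_mem _ _ _ hq
  have key := mul_measure_ball_le_lintegral (μ := vol k) (ρ := ρ) (a := density P φ F (G 0))
    (measurePreserving_smul_vol k) (hvm.const_mul c) ?_
  · rw [lintegral_const_mul _ hvm, ← mul_assoc, hc, ← ENNReal.ofReal_mul Real.two_pi_pos.le,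
      setLIntegral_congr_fun measurableSet_ball hvball] at key
    convert key using 3
    field_simp
  intro q hq
  have hq' : ‖q‖ < ρ := mem_ball_zero_iff.1 hq
  have hρ : 0 < ρ := (norm_nonneg q).trans_lt hq'
  have hmaps : ∀ z ∈ ball (0 : ℂ) (2 * ρ / (ρ + ‖q‖)), z • q ∈ ball (0 : En k) ρ := fun z hz ↦ by
    rw [mem_ball_zero_iff] at *
    rw [norm_smul]
    have h1 : ‖z‖ * ‖q‖ ≤ 2 * ρ / (ρ + ‖q‖) * ‖q‖ := by gcongr
    refine h1.trans_lt ?_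
    rw [div_mul_eq_mul_div, div_lt_iff₀ (by positivity)]
    nlinarith
  have h := density_le_lintegral_circle hφ (L := l * ρ) hP
    (fun z v ↦ by have := hu z v; simp only [levi, hess] at this; linarith) hC hF
    (η := fun z : ℂ ↦ G (z • q)) (R := 2 * ρ / (ρ + ‖q‖))
    (by rw [lt_div_iff₀ (by positivity)]; linarith)
    (hG.comp (by fun_prop) hmaps) (fun z hz ↦ by
      refine norm_deriv_le_of_lip' (by positivity) ?_
      filter_upwards [isOpen_ball.mem_nhds hz] with z' hz'
      refine (hGl _ (hmaps z' hz') _ (hmaps z hz)).trans ?_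
      rw [← sub_smul, norm_smul, mul_assoc, mul_comm ρ]
      gcongr)
  rw [zero_smul] at h
  refine h.trans_eq ?_
  rw [← lintegral_const_mul' _ _ ENNReal.ofReal_ne_top]
  refine lintegral_congr fun θ ↦ ?_
  rw [hvball]
  simpa [norm_smul, Complex.norm_exp_ofReal_mul_I] using hq'

theorem density_mul_vol_ball_le_lintegral_ball (hφ : ContDiff ℝ 2 φ) (hP : 0 < P)
    (hu : ∀ z v : En n, levi φ z v ≤ C * ‖v‖ ^ 2) (hC : 0 ≤ C) {F : En n → ℂ}
    (hF : Differentiable ℂ F) (z : En n) (s : ℝ) :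
    density P φ F z * vol n (ball 0 s) ≤ ENNReal.ofReal (Real.exp (P * (C * s ^ 2))) *
      ∫⁻ w in ball z s, density P φ F w ∂(vol n) := by
  have h := density_mul_vol_ball_le hφ hP hu hC hF (G := fun q ↦ z + q) (ρ := s) zero_le_one
    (by fun_prop) (fun q _ q' _ ↦ by simp)
  rw [add_zero, one_mul] at h
  refine h.trans_eq ?_
  congr 1
  have := (measurePreserving_add_left (vol n) z).setLIntegral_comp_preimage (s := ball z s)
    measurableSet_ball (continuous_density hP.le hφ.continuous hF.continuous).measurable
  rw [← this]
  congr 2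
  ext q
  simp

theorem IsNormalField.density_mul_vol_ball_le_lintegral {φ : En (m + 1) → ℝ}
    {T : En (m + 1) → ℂ} {δ r : ℝ} {ν : En (m + 1) → En (m + 1)} (h : IsNormalField T δ ν)
    (hr : 0 < r) (hδ : 48 * δ * r ≤ 1) (hφ : ContDiff ℝ 2 φ) (hP : 0 < P)
    (hu : ∀ z v : En (m + 1), levi φ z v ≤ C * ‖v‖ ^ 2) (hC : 0 ≤ C) {F : En (m + 1) → ℂ}
    (hF : Differentiable ℂ F) {x : En (m + 1)} (hx : T x = 0) :
    density P φ F x * vol m (ball 0 (r / 2)) ≤ ENNReal.ofReal (Real.exp (P * (C * r ^ 2))) *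
      ∫⁻ w in ball x r ∩ T ⁻¹' {0}, density P φ F w ∂(μH[(2 * m : ℝ)]) := by
  obtain ⟨G, hG0, hGd, hGm, hGl, -⟩ := h.exists_chart hx hr hδ
  have h1 := density_mul_vol_ball_le hφ hP hu hC hF zero_le_two hGd
    fun q hq q' hq' ↦ (hGl q hq q' hq').2
  rw [hG0, mul_div_cancel₀ _ two_ne_zero] at h1
  refine h1.trans ?_
  gcongr
  have hc := continuous_density hP.le hφ.continuous hF.continuous
  rw [← lintegral_map' hc.measurable.aemeasurable
    (hGd.continuousOn.aemeasurable measurableSet_ball)]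
  have hmaps : MapsTo G (ball 0 (r / 2)) (ball x r ∩ T ⁻¹' {0}) := fun q hq ↦
    ⟨(hGm q hq).2, (hGm q hq).1⟩
  exact lintegral_mono' (map_restrict_vol_le hGd.continuousOn hmaps
    fun q hq q' hq' ↦ (hGl q hq q' hq').1) le_rfl

/-- The weighted `ℓᵖ` norm over a separated sequence in a hypersurface is controlled by the weighted
`Lᵖ` norm over the hypersurface. -/
theorem IsNormalField.tsum_density_mul_le {φ : En (m + 1) → ℝ}
    {T : En (m + 1) → ℂ} {δ r : ℝ} {ν : En (m + 1) → En (m + 1)} (h : IsNormalField T δ ν)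
    (hr : 0 < r) (hδ : 48 * δ * r ≤ 1) (hφ : ContDiff ℝ 2 φ) (hP : 0 < P)
    (hu : ∀ z v : En (m + 1), levi φ z v ≤ C * ‖v‖ ^ 2) (hC : 0 ≤ C) {F : En (m + 1) → ℂ}
    (hF : Differentiable ℂ F) {S : Set (En (m + 1))} (hS : S ⊆ T ⁻¹' {0})
    (hsep : ∀ x ∈ S, ∀ y ∈ S, x ≠ y → 2 * r ≤ dist x y) :
    (∑' σ : S, density P φ F σ) * vol m (ball 0 (r / 2)) ≤
      ENNReal.ofReal (Real.exp (P * (C * r ^ 2))) *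
        ∫⁻ w in T ⁻¹' {0}, density P φ F w ∂(μH[(2 * m : ℝ)]) := by
  have hcl : MeasurableSet (T ⁻¹' {0}) :=
    (isClosed_singleton.preimage h.differentiable.continuous).measurableSet
  rw [← ENNReal.tsum_mul_right, ENNReal.tsum_eq_iSup_sum]
  refine iSup_le fun A ↦ ?_
  calc ∑ σ ∈ A, density P φ F σ * vol m (ball 0 (r / 2))
      ≤ ∑ σ ∈ A, ENNReal.ofReal (Real.exp (P * (C * r ^ 2))) *
          ∫⁻ w in ball (σ : En (m + 1)) r ∩ T ⁻¹' {0}, density P φ F w ∂(μH[(2 * m : ℝ)]) :=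
        Finset.sum_le_sum fun σ _ ↦
          h.density_mul_vol_ball_le_lintegral hr hδ hφ hP hu hC hF (hS σ.2)
    _ = ENNReal.ofReal (Real.exp (P * (C * r ^ 2))) *
          ∫⁻ w in ⋃ σ ∈ A, ball (σ : En (m + 1)) r ∩ T ⁻¹' {0}, density P φ F w
            ∂(μH[(2 * m : ℝ)]) := by
        rw [← Finset.mul_sum, lintegral_biUnion_finset]
        · intro σ _ τ _ hστ
          refine Disjoint.mono inter_subset_left inter_subset_left (ball_disjoint_ball ?_)
          have := hsep σ σ.2 τ τ.2 fun he ↦ hστ (Subtype.ext he)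
          linarith
        · exact fun σ _ ↦ measurableSet_ball.inter hcl
    _ ≤ _ := by
        gcongr
        exact iUnion₂_subset fun σ _ ↦ inter_subset_right

/-- The weighted `Lᵖ` norm over the hypersurface is controlled by the one over `ℂⁿ`. -/
theorem IsNormalField.lintegral_density_mul_le {φ : En (m + 1) → ℝ}
    {T : En (m + 1) → ℂ} {δ r : ℝ} {ν : En (m + 1) → En (m + 1)} (h : IsNormalField T δ ν)
    (hr : 0 < r) (hδ : 48 * δ * r ≤ 1) (hφ : ContDiff ℝ 2 φ) (hP : 0 < P)
    (hu : ∀ z v : En (m + 1), levi φ z v ≤ C * ‖v‖ ^ 2) (hC : 0 ≤ C) {F : En (m + 1) → ℂ}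
    (hF : Differentiable ℂ F) :
    (∫⁻ w in T ⁻¹' {0}, density P φ F w ∂(μH[(2 * m : ℝ)])) * vol (m + 1) (ball 0 (r / 4)) ≤
      ENNReal.ofReal (Real.exp (P * (C * (r / 4) ^ 2))) *
        ((2 : ℝ≥0∞) ^ (2 * m : ℝ) * vol m (ball 0 (r / 2))) *
        ∫⁻ z, density P φ F z ∂(vol (m + 1)) := by
  set μ : Measure (En (m + 1)) := (μH[(2 * m : ℝ)]).restrict (T ⁻¹' {0}) with hμ
  set K := ENNReal.ofReal (Real.exp (P * (C * (r / 4) ^ 2))) with hK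
  set A := (2 : ℝ≥0∞) ^ (2 * m : ℝ) * vol m (ball 0 (r / 2)) with hA
  have hμb : ∀ z, μ (ball z (r / 4)) ≤ A := fun z ↦ by
    rw [hμ, Measure.restrict_apply measurableSet_ball]
    exact h.hausdorffMeasure_inter_ball_le hr hδ z
  have hAt : A < ⊤ := ENNReal.mul_lt_top (ENNReal.rpow_lt_top_of_nonneg (by positivity) (by simp))
    measure_ball_lt_top
  have : IsLocallyFiniteMeasure μ :=
    ⟨fun z ↦ ⟨ball z (r / 4), ball_mem_nhds _ (by positivity), (hμb z).trans_lt hAt⟩⟩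
  have hc := (continuous_density hP.le hφ.continuous hF.continuous).measurable
  have hset : MeasurableSet {p : En (m + 1) × En (m + 1) | dist p.2 p.1 < r / 4} :=
    (isOpen_lt (by fun_prop) continuous_const).measurableSet
  have hmeas : Measurable fun p : En (m + 1) × En (m + 1) ↦
      {p : En (m + 1) × En (m + 1) | dist p.2 p.1 < r / 4}.indicator
        (fun p ↦ density P φ F p.2) p :=
    (hc.comp measurable_snd).indicator hset
  calc (∫⁻ w, density P φ F w ∂μ) * vol (m + 1) (ball 0 (r / 4))
      = ∫⁻ w, density P φ F w * vol (m + 1) (ball 0 (r / 4)) ∂μ :=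
        (lintegral_mul_const _ hc).symm
    _ ≤ ∫⁻ w, K * ∫⁻ z in ball w (r / 4), density P φ F z ∂(vol (m + 1)) ∂μ :=
        lintegral_mono fun w ↦
          density_mul_vol_ball_le_lintegral_ball hφ hP hu hC hF w (r / 4)
    _ = K * ∫⁻ w, ∫⁻ z, {p : En (m + 1) × En (m + 1) | dist p.2 p.1 < r / 4}.indicator
          (fun p ↦ density P φ F p.2) (w, z) ∂(vol (m + 1)) ∂μ := by
        rw [lintegral_const_mul' _ _ ENNReal.ofReal_ne_top]
        congr 1
        refine lintegral_congr fun w ↦ ?_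
        rw [← lintegral_indicator measurableSet_ball]
        rfl
    _ = K * ∫⁻ z, ∫⁻ w, {p : En (m + 1) × En (m + 1) | dist p.2 p.1 < r / 4}.indicator
          (fun p ↦ density P φ F p.2) (w, z) ∂μ ∂(vol (m + 1)) := by
        rw [lintegral_lintegral_swap hmeas.aemeasurable]
    _ = K * ∫⁻ z, density P φ F z * μ (ball z (r / 4)) ∂(vol (m + 1)) := by
        congr 1
        refine lintegral_congr fun z ↦ ?_
        rw [← lintegral_indicator_const measurableSet_ball]
        refine lintegral_congr fun w ↦ ?_
        by_cases hw : dist w z < r / 4 <;> simp [indicator, dist_comm z w, hw]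
    _ ≤ K * ∫⁻ z, density P φ F z * A ∂(vol (m + 1)) := by
        gcongr with z
        exact hμb z
    _ = _ := by
        rw [lintegral_mul_const _ hc, mul_comm _ A, mul_assoc K]

end SubMean

section Assembly

theorem IsSamplingHyp.of_le {n : ℕ} {p : ℝ≥0∞} {φ : En n → ℝ} {W : Set (En n)} {M : ℝ≥0∞}
    (hM : M ≠ ⊤) (h : ∀ F : En n → ℂ, Differentiable ℂ F → wNorm p φ (vol n) univ F < ⊤ →
      wNorm p φ (vol n) univ F ≤ M * wNorm p φ (surf n W) W F ∧
      wNorm p φ (surf n W) W F ≤ M * wNorm p φ (vol n) univ F) : IsSamplingHyp p φ W := by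
  have hle : M ≤ ENNReal.ofReal (M.toReal + 1) := by
    rw [ENNReal.ofReal_add ENNReal.toReal_nonneg zero_le_one, ENNReal.ofReal_toReal hM]
    exact le_self_add
  refine ⟨M.toReal + 1, by positivity, fun F hF hFn ↦ ⟨(h F hF hFn).1.trans ?_,
    (h F hF hFn).2.trans ?_⟩⟩ <;> gcongr

theorem IsSamplingSeq.isSamplingHyp_top {n : ℕ} {φ : En n → ℝ} {S W : Set (En n)} (hSW : S ⊆ W)
    (hS : IsSamplingSeq ⊤ φ S) : IsSamplingHyp ⊤ φ W := by
  obtain ⟨M, -, hM⟩ := hS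
  refine .of_le (M := ENNReal.ofReal M + 1) (by simp) fun F hF hFn ↦ ⟨?_, ?_⟩
  · refine (hM F hF hFn).1.trans (mul_le_mul' le_self_add ?_)
    simp only [seqNorm, wNorm, if_true]
    exact biSup_mono hSW
  · refine le_trans ?_ (le_mul_of_one_le_left' le_add_self)
    simp only [wNorm, if_true]
    exact biSup_mono (subset_univ W)

theorem UniformlyFlat.nonempty {n : ℕ} {W : Set (En n)} (hW : UniformlyFlat W) : W.Nonempty := by
  obtain ⟨ε, hε, pr, -, hpr⟩ := hW
  by_contra h
  rw [not_nonempty_iff_eq_empty] at h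
  exact (h ▸ (hpr 0 (by simpa [h] using hε)).1 : pr 0 ∈ (∅ : Set (En n)))

theorem wNorm_vol_univ {n : ℕ} {p : ℝ≥0∞} (hp : p ≠ ⊤) (φ : En n → ℝ) (F : En n → ℂ) :
    wNorm p φ (vol n) univ F = ∫⁻ z, density p.toReal φ F z ∂(vol n) := by
  simp only [wNorm, if_neg hp, Measure.restrict_univ, density]

theorem seqNorm_eq_tsum_density {n : ℕ} {p : ℝ≥0∞} (hp : p ≠ ⊤) (φ : En n → ℝ) (S : Set (En n))
    (F : En n → ℂ) : seqNorm p φ S F = ∑' σ : S, density p.toReal φ F σ := by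
  simp only [seqNorm, if_neg hp, density]

theorem wNorm_surf {m : ℕ} {p : ℝ≥0∞} (hp : p ≠ ⊤) (φ : En (m + 1) → ℝ) {W : Set (En (m + 1))}
    (hW : MeasurableSet W) (F : En (m + 1) → ℂ) :
    wNorm p φ (surf (m + 1) W) W F =
      2 ^ m * (m.factorial : ℝ≥0∞) * ∫⁻ z in W, density p.toReal φ F z ∂(μH[(2 * m : ℝ)]) := by
  have hd : (2 * ((m + 1 : ℕ) : ℝ) - 2 : ℝ) = 2 * m := by push_cast; ring
  simp only [wNorm, if_neg hp, surf, Measure.restrict_smul, Measure.restrict_restrict hW, inter_self,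
    lintegral_smul_measure, smul_eq_mul, hd, Nat.add_sub_cancel, density]

end Assembly

/-- **Lemma (from a sampling sequence on `W` to sampling for `W`).**  If
`cω ≤ i∂∂̄φ ≤ Cω`, `1 ≤ p ≤ ∞`, `W = T⁻¹(0)` is uniformly flat and `Σ ⊂ W` is a
uniformly separated sampling sequence for `BF^p_φ(ℂⁿ)`, then `W` is a sampling
hypersurface for `BF^p_φ(ℂⁿ)`. -/
theorem sampling_sequence_to_hypersurface
    (n : ℕ) (φ : En n → ℝ) (hφ : ContDiff ℝ 2 φ)
    (c C : ℝ) (hc : 0 < c) (hcC : c ≤ C)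
    (hl : ∀ z v : En n, c * ‖v‖ ^ 2 ≤ levi φ z v)
    (hu : ∀ z v : En n, levi φ z v ≤ C * ‖v‖ ^ 2)
    (p : ℝ≥0∞) (hp : 1 ≤ p)
    (T : En n → ℂ) (hT : Differentiable ℂ T)
    (W : Set (En n)) (hWT : W = T ⁻¹' {0})
    (hdT : ∀ z ∈ W, fderiv ℂ T z ≠ 0)
    (hflat : UniformlyFlat W)
    (S : Set (En n)) (hSW : S ⊆ W) (hsep : UnifSep S)
    (hsamp : IsSamplingSeq p φ S) :
    IsSamplingHyp p φ W := by
  subst hWT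
  by_cases hpt : p = ⊤
  · subst hpt
    exact hsamp.isSamplingHyp_top hSW
  obtain _ | m := n
  · obtain ⟨z, hz⟩ := hflat.nonempty
    exact absurd (Subsingleton.elim _ _) (hdT z hz)
  obtain ⟨δ, ν, h⟩ := hflat.exists_isNormalField hT hdT
  obtain ⟨s, hs, hsep⟩ := hsep
  obtain ⟨M, -, hM⟩ := hsamp
  have hδ := h.pos
  set r := min (1 / (48 * δ)) (s / 2) with hr
  have hr0 : 0 < r := by positivity
  have hrδ : 48 * δ * r ≤ 1 := by
    have : r ≤ 1 / (48 * δ) := min_le_left _ _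
    rwa [le_div_iff₀ (by positivity), mul_comm] at this
  have hrs : 2 * r ≤ s := by linarith [min_le_right (1 / (48 * δ)) (s / 2)]
  have hP : 0 < p.toReal := ENNReal.toReal_pos (one_pos.trans_le hp).ne' hpt
  have hC : 0 ≤ C := hc.le.trans hcC
  have hW : MeasurableSet (T ⁻¹' {0}) :=
    (isClosed_singleton.preimage hT.continuous).measurableSet
  have hb : ∀ (k : ℕ) {t : ℝ}, 0 < t → vol k (ball 0 t) ≠ 0 ∧ vol k (ball 0 t) ≠ ⊤ :=
    fun k t ht ↦ ⟨(measure_ball_pos _ _ ht).ne', measure_ball_lt_top.ne⟩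
  obtain ⟨hb0, hbt⟩ := hb m (half_pos hr0)
  obtain ⟨hB0, hBt⟩ := hb (m + 1) (t := r / 4) (by positivity)
  set b := vol m (ball 0 (r / 2))
  set B := vol (m + 1) (ball 0 (r / 4))
  set κ : ℝ≥0∞ := 2 ^ m * (m.factorial : ℝ≥0∞) with hκ
  have hκt : κ ≠ ⊤ := ENNReal.mul_ne_top (by simp) (by simp)
  have hκ1 : 1 ≤ κ := one_le_mul (one_le_pow₀ one_le_two)
    (by exact_mod_cast Nat.one_le_iff_ne_zero.2 m.factorial_ne_zero)
  set K₁ := ENNReal.ofReal (Real.exp (p.toReal * (C * r ^ 2))) / b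
  set K₂ := ENNReal.ofReal (Real.exp (p.toReal * (C * (r / 4) ^ 2))) *
    ((2 : ℝ≥0∞) ^ (2 * m : ℝ) * b) / B
  have hK₁ : K₁ ≠ ⊤ := ENNReal.div_ne_top ENNReal.ofReal_ne_top hb0
  have hK₂ : K₂ ≠ ⊤ := ENNReal.div_ne_top (ENNReal.mul_ne_top ENNReal.ofReal_ne_top
    (ENNReal.mul_ne_top (ENNReal.rpow_ne_top_of_nonneg (by positivity) (by simp)) hbt)) hB0
  refine .of_le (M := ENNReal.ofReal M * K₁ + κ * K₂) (by finiteness) fun F hF hFn ↦ ?_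
  have h₁ := h.tsum_density_mul_le hr0 hrδ hφ hP hu hC hF hSW
    fun x hx y hy hxy ↦ hrs.trans (hsep x hx y hy hxy)
  have h₂ := h.lintegral_density_mul_le hr0 hrδ hφ hP hu hC hF
  rw [← ENNReal.le_div_iff_mul_le (.inl hb0) (.inl hbt), ENNReal.mul_div_right_comm,
    ← seqNorm_eq_tsum_density hpt] at h₁
  rw [← ENNReal.le_div_iff_mul_le (.inl hB0) (.inl hBt), ENNReal.mul_div_right_comm,
    ← wNorm_vol_univ hpt] at h₂
  rw [wNorm_surf hpt φ hW]
  constructor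
  · calc wNorm p φ (vol (m + 1)) univ F ≤ ENNReal.ofReal M * seqNorm p φ S F := (hM F hF hFn).1
      _ ≤ ENNReal.ofReal M * (K₁ *
          ∫⁻ z in T ⁻¹' {0}, density p.toReal φ F z ∂(μH[(2 * m : ℝ)])) := by gcongr
      _ ≤ _ := by
        rw [← mul_assoc]
        exact mul_le_mul' le_self_add (le_mul_of_one_le_left' hκ1)
  · calc κ * ∫⁻ z in T ⁻¹' {0}, density p.toReal φ F z ∂(μH[(2 * m : ℝ)])
        ≤ κ * (K₂ * wNorm p φ (vol (m + 1)) univ F) := by gcongr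
      _ ≤ _ := by
        rw [← mul_assoc]
        exact mul_le_mul' le_add_self le_rfl
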